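/- Let q be a 2way-determined query and D a database. If some q-connected component C of D contains a triangle-tripath of q and also contains three facts d,e,f such that (d,e) and (e,f) are distinct solutions to q in C and (f,d) is not a solution to q in C (a fork), then q admits a fork-tripath. -/

import Mathlib

/- Consistent query answering framework: a single relation symbol of arity `n`
   whose first `l` positions form the primary key. Facts are `Fin n → Elem`,
   atoms are `Fin n → Var`. -/

namespace CQA

/-- Key-equality: the tuples of the first `l` entries coincide. -/
def keyEq (l : ℕ) {n : ℕ} {α : Type*} (s t : Fin n → α) : Prop :=
  ∀ i : Fin n, (i : ℕ) < l → s i = t i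

/-- The set of entries occurring in the first `l` (key) positions of a tuple. -/
def keySet (l : ℕ) {n : ℕ} {α : Type*} (t : Fin n → α) : Set α :=
  {x | ∃ i : Fin n, (i : ℕ) < l ∧ t i = x}

/-- The set of all entries of a tuple. -/
def varsSet {n : ℕ} {α : Type*} (t : Fin n → α) : Set α :=
  Set.range t

/-- A (two-atom, Boolean, self-join) query `q = AB` is a pair of atoms. -/
abbrev Query (n : ℕ) (Var : Type*) := (Fin n → Var) × (Fin n → Var)

variable {n : ℕ} {Elem Var : Type*}

/-- The pair of facts `(a, b)` matches the two atoms of `q` via a single assignment `μ`. -/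
def solPair (q : Query n Var) (a b : Fin n → Elem) : Prop :=
  ∃ μ : Var → Elem, (∀ i, μ (q.1 i) = a i) ∧ (∀ i, μ (q.2 i) = b i)

/-- `D ⊨ q(ab)` : `(a,b)` is a solution to `q` in `D`. -/
def Sol (q : Query n Var) (D : Set (Fin n → Elem)) (a b : Fin n → Elem) : Prop :=
  a ∈ D ∧ b ∈ D ∧ solPair q a b

/-- `D ⊨ q{ab}` : `(a,b)` or `(b,a)` is a solution to `q` in `D`. -/
def SolSym (q : Query n Var) (D : Set (Fin n → Elem)) (a b : Fin n → Elem) : Prop :=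
  Sol q D a b ∨ Sol q D b a

/-- The set `q(D)` of solutions to `q` in `D`. -/
def solSet (q : Query n Var) (D : Set (Fin n → Elem)) :
    Set ((Fin n → Elem) × (Fin n → Elem)) :=
  {p | Sol q D p.1 p.2}

/-- `D ⊨ q` : some solution to `q` exists in `D`. -/
def Sat (q : Query n Var) (D : Set (Fin n → Elem)) : Prop :=
  ∃ a b, Sol q D a b

/-- A database is consistent if it contains no two distinct key-equal facts. -/
def Consistent (l : ℕ) (D : Set (Fin n → Elem)) : Prop :=
  ∀ a ∈ D, ∀ b ∈ D, keyEq l a b → a = b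

/-- `r` is a repair of `D` : a maximal consistent subset of `D`. -/
def Repair (l : ℕ) (D r : Set (Fin n → Elem)) : Prop :=
  r ⊆ D ∧ Consistent l r ∧ ∀ s, r ⊆ s → s ⊆ D → Consistent l s → s = r

/-- `D ⊨ certain(q)` : all repairs of `D` satisfy `q`. -/
def Certain (l : ℕ) (q : Query n Var) (D : Set (Fin n → Elem)) : Prop :=
  ∀ r, Repair l D r → Sat q r

/-- The block of the fact `a` in `D`: all facts of `D` key-equal to `a`. -/
def Block (l : ℕ) (D : Set (Fin n → Elem)) (a : Fin n → Elem) : Set (Fin n → Elem) :=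
  {b ∈ D | keyEq l a b}

/-- A `k`-set of `D`: at most `k` facts of `D`, at most one from each block. -/
def kSet (l k : ℕ) (D S : Set (Fin n → Elem)) : Prop :=
  S ⊆ D ∧ S.Finite ∧ S.ncard ≤ k ∧ Consistent l S

/-- A collection `𝒮` of sets of facts is closed under the two rules defining `Δ_k(q,D)`:
  (i) every `k`-set satisfying `q` is in `𝒮`, and (ii) if for a `k`-set `S` there is
  a block of `D` each of whose facts `u` admits a subset `S' ⊆ S ∪ {u}` that is a
  `k`-set belonging to `𝒮`, then `S ∈ 𝒮`. -/
def DeltaClosed (l k : ℕ) (q : Query n Var) (D : Set (Fin n → Elem))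
    (𝒮 : Set (Set (Fin n → Elem))) : Prop :=
  (∀ S, kSet l k D S → Sat q S → S ∈ 𝒮) ∧
  (∀ S, kSet l k D S → (∃ x ∈ D, ∀ u ∈ D, keyEq l x u →
      ∃ S', S' ⊆ S ∪ {u} ∧ kSet l k D S' ∧ S' ∈ 𝒮) → S ∈ 𝒮)

/-- `Δ_k(q,D)`: the least collection of `k`-sets of `D` closed under the two rules
(the intersection of all closed collections). -/
def Delta (l k : ℕ) (q : Query n Var) (D : Set (Fin n → Elem)) :
    Set (Set (Fin n → Elem)) :=
  ⋂₀ {𝒮 | DeltaClosed l k q D 𝒮}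

/-- `q = AB` is 2way-determined. -/
def TwoWayDet (l : ℕ) (q : Query n Var) : Prop :=
  ¬ keySet l q.1 ⊆ keySet l q.2 ∧ ¬ keySet l q.2 ⊆ keySet l q.1 ∧
  keySet l q.1 ⊆ varsSet q.2 ∧ keySet l q.2 ⊆ varsSet q.1

/-- The zig-zag property of a query `q`, relative to databases over `Elem`. -/
def ZigZag (l : ℕ) (q : Query n Var) (Elem : Type*) : Prop :=
  ∀ D : Set (Fin n → Elem), D.Finite →
    ∀ a b b' c : Fin n → Elem, a ∈ D → b ∈ D → b' ∈ D → c ∈ D →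
      ¬ keyEq l a c → a ≠ b → keyEq l b b' →
      Sol q D a b → Sol q D c b' → Sol q D a b'

/-- `rkey(a, r)`: facts of `r` whose key entries are included in those of `a`. -/
def rkey (l : ℕ) (r : Set (Fin n → Elem)) (a : Fin n → Elem) : Set (Fin n → Elem) :=
  {c ∈ r | keySet l c ⊆ keySet l a}

open Classical in
/-- `g(e)`, the set of entries of the tuple `g̅(e)`, for `e` branching with `d, f`. -/
noncomputable def gSet (l : ℕ) (d e f : Fin n → Elem) : Set Elem :=
  if keySet l d ⊆ keySet l e ∧ ¬ keySet l f ⊆ keySet l e then keySet l d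
  else if ¬ keySet l d ⊆ keySet l e ∧ keySet l f ⊆ keySet l e then keySet l f
  else if keySet l d ⊆ keySet l f ∧ keySet l f ⊆ keySet l e then keySet l d
  else if keySet l f ⊆ keySet l d ∧ keySet l d ⊆ keySet l e then keySet l f
  else keySet l e

/-- A tripath of `q`: a database `Θ`, each of whose blocks has at most two facts,
whose blocks (indexed by `Fin m`) are arranged as a rooted tree with exactly one root
block and exactly two leaf blocks; the root block has the single fact `a(root)`, leaf
blocks have the single fact `b(leaf)`, all other blocks have exactly the two facts
`a(B) ≠ b(B)`; if `B` is the parent of `B'` then `Θ ⊨ q{a(B) b(B')}`; the (unique)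
branching block `B` with its two children `B', B''` gives the center `d e f` =
`b(B') a(B) b(B'')` with `(d,e)` and `(e,f)` distinct solutions; and `g(e)` is not
included in the key of the root fact nor of either leaf fact. -/
structure Tripath (l : ℕ) (q : Query n Var) (Θ : Set (Fin n → Elem)) where
  finite : Θ.Finite
  m : ℕ
  blk : Fin m → Set (Fin n → Elem)
  blk_is_block : ∀ i, ∃ x ∈ Θ, blk i = Block l Θ x
  blk_cover : Θ = ⋃ i, blk i
  blk_inj : Function.Injective blk
  blk_card : ∀ i, (blk i).ncard ≤ 2
  parent : Fin m → Option (Fin m)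
  root : Fin m
  parent_root : parent root = none
  parent_ne_root : ∀ i, i ≠ root → ∃ j, parent i = some j
  reach_root : ∀ i, Relation.ReflTransGen (fun x y => parent x = some y) i root
  leaf1 : Fin m
  leaf2 : Fin m
  leaf_ne : leaf1 ≠ leaf2
  leaf1_leaf : ∀ j, parent j ≠ some leaf1
  leaf2_leaf : ∀ j, parent j ≠ some leaf2
  leaves_eq : ∀ i, (∀ j, parent j ≠ some i) → i = leaf1 ∨ i = leaf2
  aFact : Fin m → (Fin n → Elem)
  bFact : Fin m → (Fin n → Elem)
  root_blk : blk root = {aFact root}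
  leaf1_blk : blk leaf1 = {bFact leaf1}
  leaf2_blk : blk leaf2 = {bFact leaf2}
  other_blk : ∀ i, i ≠ root → i ≠ leaf1 → i ≠ leaf2 →
    aFact i ≠ bFact i ∧ blk i = {aFact i, bFact i}
  adj_sol : ∀ i j, parent j = some i → SolSym q Θ (aFact i) (bFact j)
  branch : Fin m
  child1 : Fin m
  child2 : Fin m
  child_ne : child1 ≠ child2
  parent_child1 : parent child1 = some branch
  parent_child2 : parent child2 = some branch
  center_sol1 : Sol q Θ (bFact child1) (aFact branch)
  center_sol2 : Sol q Θ (aFact branch) (bFact child2)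
  center_distinct : (bFact child1, aFact branch) ≠ (aFact branch, bFact child2)
  g_root : ¬ gSet l (bFact child1) (aFact branch) (bFact child2) ⊆ keySet l (aFact root)
  g_leaf1 : ¬ gSet l (bFact child1) (aFact branch) (bFact child2) ⊆ keySet l (bFact leaf1)
  g_leaf2 : ¬ gSet l (bFact child1) (aFact branch) (bFact child2) ⊆ keySet l (bFact leaf2)

namespace Tripath

variable {l : ℕ} {q : Query n Var} {Θ : Set (Fin n → Elem)}

/-- The fact `d` of the center `def` of a tripath. -/
def dc (T : Tripath l q Θ) : Fin n → Elem := T.bFact T.child1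
/-- The fact `e` of the center `def` of a tripath. -/
def ec (T : Tripath l q Θ) : Fin n → Elem := T.aFact T.branch
/-- The fact `f` of the center `def` of a tripath. -/
def fc (T : Tripath l q Θ) : Fin n → Elem := T.bFact T.child2
/-- The root fact `u₀` of a tripath. -/
def u0 (T : Tripath l q Θ) : Fin n → Elem := T.aFact T.root
/-- The leaf fact `u₁` of a tripath. -/
def u1 (T : Tripath l q Θ) : Fin n → Elem := T.bFact T.leaf1
/-- The leaf fact `u₂` of a tripath. -/
def u2 (T : Tripath l q Θ) : Fin n → Elem := T.bFact T.leaf2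

/-- The center of the tripath is a fork (`(f,d)` is not a solution). -/
def IsFork (T : Tripath l q Θ) : Prop := ¬ Sol q Θ T.fc T.dc

/-- The center of the tripath is a triangle (`(f,d)` is a solution). -/
def IsTriangle (T : Tripath l q Θ) : Prop := Sol q Θ T.fc T.dc

/-- Variable-niceness witnessed by the elements `x, y, z`. -/
def VariableNiceWith (T : Tripath l q Θ) (x y z : Elem) : Prop :=
  x ∈ keySet l T.dc ∧ y ∈ keySet l T.ec ∧ z ∈ keySet l T.fc ∧
  ({x, y, z} : Set Elem) ∩ (keySet l T.u0 ∪ keySet l T.u1 ∪ keySet l T.u2) = ∅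

/-- The tripath is variable-nice. -/
def VariableNice (T : Tripath l q Θ) : Prop := ∃ x y z, T.VariableNiceWith x y z

/-- The tripath is solution-nice: the only solutions to `q` in `Θ` are those between a
parent block and a child block, plus possibly `(f, d)`. -/
def SolutionNice (T : Tripath l q Θ) : Prop :=
  ∀ a b, Sol q Θ a b →
    (∃ i j, T.parent j = some i ∧
      ((a = T.aFact i ∧ b = T.bFact j) ∨ (a = T.bFact j ∧ b = T.aFact i)))
    ∨ (a = T.fc ∧ b = T.dc)

/-- The tripath is nice. -/
def Nice (T : Tripath l q Θ) : Prop :=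
  (∃ x y z : Elem, T.VariableNiceWith x y z ∧
    ∃ w ∈ ({x, y, z} : Set Elem),
      ∀ c ∈ Θ, c ≠ T.u0 → c ≠ T.u1 → c ≠ T.u2 → w ∈ keySet l c) ∧
  T.SolutionNice ∧
  (∀ u ∈ ({T.u0, T.u1, T.u2} : Set (Fin n → Elem)),
    ∃ w ∈ keySet l u, ∀ c ∈ Θ, c ≠ u → w ∉ keySet l c)

end Tripath

/-- `D` contains a tripath of `q`: some subset of `D` is a tripath of `q`. -/
def ContainsTripath (l : ℕ) (q : Query n Var) (D : Set (Fin n → Elem)) : Prop :=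
  ∃ Θ ⊆ D, Nonempty (Tripath l q Θ)

/-- `q` admits a fork-tripath (over databases with elements in `Elem`). -/
def AdmitsForkTripath (l : ℕ) (q : Query n Var) (Elem : Type*) : Prop :=
  ∃ D : Set (Fin n → Elem), D.Finite ∧ ∃ Θ ⊆ D, ∃ T : Tripath l q Θ, T.IsFork

/-- `q` admits a triangle-tripath (over databases with elements in `Elem`). -/
def AdmitsTriangleTripath (l : ℕ) (q : Query n Var) (Elem : Type*) : Prop :=
  ∃ D : Set (Fin n → Elem), D.Finite ∧ ∃ Θ ⊆ D, ∃ T : Tripath l q Θ, T.IsTriangle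

/-- `q` admits a tripath (over databases with elements in `Elem`). -/
def AdmitsTripath (l : ℕ) (q : Query n Var) (Elem : Type*) : Prop :=
  ∃ D : Set (Fin n → Elem), D.Finite ∧ ContainsTripath l q D

/-- Edges of the solution graph `G(D,q)`: distinct facts `a, b` of `D` with `D ⊨ q{ab}`. -/
def gEdge (q : Query n Var) (D : Set (Fin n → Elem)) (a b : Fin n → Elem) : Prop :=
  a ≠ b ∧ a ∈ D ∧ b ∈ D ∧ SolSym q D a b

/-- The connected component of the fact `a` in the solution graph `G(D,q)`. -/
def gComp (q : Query n Var) (D : Set (Fin n → Elem)) (a : Fin n → Elem) :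
    Set (Fin n → Elem) :=
  {b ∈ D | Relation.ReflTransGen (gEdge q D) a b}

/-- `C` is a quasi-clique (of the solution graph of `D`): any two non-key-equal facts of
`C` are joined by an edge. -/
def QuasiClique (l : ℕ) (q : Query n Var) (D : Set (Fin n → Elem))
    (C : Set (Fin n → Elem)) : Prop :=
  ∀ a ∈ C, ∀ b ∈ C, ¬ keyEq l a b → SolSym q D a b

open Classical in
/-- `clique(a)`: the connected component of `a` in `G(D,q)` if it is a quasi-clique, and
`{a}` otherwise. -/
noncomputable def cliqueOf (l : ℕ) (q : Query n Var) (D : Set (Fin n → Elem))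
    (a : Fin n → Elem) : Set (Fin n → Elem) :=
  if QuasiClique l q D (gComp q D a) then gComp q D a else {a}

/-- Edges of the bipartite graph `H(D,q)`: between a block `B` of `D` and a set `c` of
the form `clique(y)`, when `B` contains a fact `a ∈ c` with `(a,a)` not a solution. -/
def HEdge (l : ℕ) (q : Query n Var) (D : Set (Fin n → Elem))
    (B c : Set (Fin n → Elem)) : Prop :=
  (∃ x ∈ D, B = Block l D x) ∧ (∃ y ∈ D, c = cliqueOf l q D y) ∧
  ∃ a ∈ B, a ∈ c ∧ ¬ Sol q D a a

/-- `H(D,q)` admits a matching saturating the set `V₁` of blocks of `D`: an injective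
assignment of an `H`-edge to every block. -/
def SaturatingMatching (l : ℕ) (q : Query n Var) (D : Set (Fin n → Elem)) : Prop :=
  ∃ M : Set (Fin n → Elem) → Set (Fin n → Elem),
    (∀ x ∈ D, HEdge l q D (Block l D x) (M (Block l D x))) ∧
    (∀ x ∈ D, ∀ y ∈ D, M (Block l D x) = M (Block l D y) → Block l D x = Block l D y)

/-- `D` is a clique-database for `q`: every connected component of `G(D,q)` is a
quasi-clique. -/
def CliqueDB (l : ℕ) (q : Query n Var) (D : Set (Fin n → Elem)) : Prop :=
  ∀ a ∈ D, QuasiClique l q D (gComp q D a)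

/-- `q` is a clique-query: every database (over `Elem`) is a clique-database for `q`. -/
def CliqueQuery (l : ℕ) (q : Query n Var) (Elem : Type*) : Prop :=
  ∀ D : Set (Fin n → Elem), D.Finite → CliqueDB l q D

/-- One step of `q`-connectedness between (the blocks of) two facts of `D`:
either they are in the same block, or some fact of the block of `x` and some fact
of the block of `y` form a solution. -/
def qConnRel (l : ℕ) (q : Query n Var) (D : Set (Fin n → Elem))
    (x y : Fin n → Elem) : Prop :=
  keyEq l x y ∨ ∃ a b, a ∈ Block l D x ∧ b ∈ Block l D y ∧ SolSym q D a b

/-- The blocks of `x` and of `y` are `q`-connected in `D`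
(reflexive-symmetric-transitive closure). -/
def qConn (l : ℕ) (q : Query n Var) (D : Set (Fin n → Elem))
    (x y : Fin n → Elem) : Prop :=
  Relation.EqvGen (qConnRel l q D) x y

/-- The `q`-connected component of (the block of) the fact `x` in `D`. -/
def qComponent (l : ℕ) (q : Query n Var) (D : Set (Fin n → Elem))
    (x : Fin n → Elem) : Set (Fin n → Elem) :=
  {y ∈ D | qConn l q D x y}

end CQA

namespace CQA
section helpers
variable {n : ℕ} {Elem Var : Type}

/-- The position/level graph. -/
def LAdj (l : ℕ) (q : Query n Var) (u v : Fin n × ℤ) : Prop :=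
  ((u.1 : ℕ) < l ∧ (v.1 : ℕ) < l) ∧
  ((u.2 = v.2 ∧ (q.1 u.1 = q.1 v.1 ∨ q.2 u.1 = q.2 v.1)) ∨
   (u.2 = v.2 + 1 ∧ q.1 u.1 = q.2 v.1) ∨ (v.2 = u.2 + 1 ∧ q.1 v.1 = q.2 u.1))

def LConn (l : ℕ) (q : Query n Var) (u v : Fin n × ℤ) : Prop :=
  Relation.ReflTransGen (LAdj l q) u v

def PA (l : ℕ) (q : Query n Var) (t : Fin n → Elem) : Prop :=
  ∀ p p' : Fin n, (p : ℕ) < l → (p' : ℕ) < l → q.1 p = q.1 p' → t p = t p'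
def PB (l : ℕ) (q : Query n Var) (t : Fin n → Elem) : Prop :=
  ∀ p p' : Fin n, (p : ℕ) < l → (p' : ℕ) < l → q.2 p = q.2 p' → t p = t p'

theorem PA_of_sol {l : ℕ} {q : Query n Var} {a b : Fin n → Elem} (h : solPair q a b) :
    PA l q a := by
  obtain ⟨μ, h1, h2⟩ := h
  intro p p' _ _ hpp
  rw [← h1, ← h1, hpp]

theorem PB_of_sol {l : ℕ} {q : Query n Var} {a b : Fin n → Elem} (h : solPair q a b) :
    PB l q b := by
  obtain ⟨μ, h1, h2⟩ := h
  intro p p' _ _ hpp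
  rw [← h2, ← h2, hpp]

theorem keyEq_symm {l : ℕ} {a b : Fin n → Elem} (h : keyEq l a b) : keyEq l b a :=
  fun i hi => (h i hi).symm
theorem keyEq_trans {l : ℕ} {a b c : Fin n → Elem} (h : keyEq l a b) (h' : keyEq l b c) :
    keyEq l a c := fun i hi => (h i hi).trans (h' i hi)
theorem keyEq_rfl {l : ℕ} {a : Fin n → Elem} : keyEq l a a := fun _ _ => rfl

theorem keySet_congr {l : ℕ} {a b : Fin n → Elem} (h : keyEq l a b) :
    keySet l a = keySet l b := by
  ext x
  constructor
  · rintro ⟨i, hi, rfl⟩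
    exact ⟨i, hi, (h i hi).symm⟩
  · rintro ⟨i, hi, rfl⟩
    exact ⟨i, hi, h i hi⟩

theorem PA_congr {l : ℕ} {q : Query n Var} {a b : Fin n → Elem} (h : keyEq l a b)
    (ha : PA l q a) : PA l q b := by
  intro p p' hp hp' e
  rw [← h p hp, ← h p' hp', ha p p' hp hp' e]
theorem PB_congr {l : ℕ} {q : Query n Var} {a b : Fin n → Elem} (h : keyEq l a b)
    (ha : PB l q a) : PB l q b := by
  intro p p' hp hp' e
  rw [← h p hp, ← h p' hp', ha p p' hp hp' e]

theorem LAdj_symm {l : ℕ} {q : Query n Var} {u v : Fin n × ℤ} (h : LAdj l q u v) :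
    LAdj l q v u := by
  obtain ⟨⟨h1, h2⟩, h⟩ := h
  refine ⟨⟨h2, h1⟩, ?_⟩
  rcases h with ⟨h, h' | h'⟩ | ⟨h, h'⟩ | ⟨h, h'⟩
  · exact Or.inl ⟨h.symm, Or.inl h'.symm⟩
  · exact Or.inl ⟨h.symm, Or.inr h'.symm⟩
  · exact Or.inr (Or.inr ⟨h, h'⟩)
  · exact Or.inr (Or.inl ⟨h, h'⟩)

theorem LConn_symm {l : ℕ} {q : Query n Var} {u v : Fin n × ℤ} (h : LConn l q u v) :
    LConn l q v u := by
  induction h with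
  | refl => exact Relation.ReflTransGen.refl
  | tail _ h ih => exact Relation.ReflTransGen.head (LAdj_symm h) ih

theorem LConn_trans {l : ℕ} {q : Query n Var} {u v w : Fin n × ℤ} (h : LConn l q u v)
    (h' : LConn l q v w) : LConn l q u w := Relation.ReflTransGen.trans h h'

theorem LConn_shift {l : ℕ} {q : Query n Var} {u v : Fin n × ℤ} (c : ℤ) (h : LConn l q u v) :
    LConn l q (u.1, u.2 + c) (v.1, v.2 + c) := by
  induction h with
  | refl => exact Relation.ReflTransGen.refl
  | tail _ h ih =>
    refine Relation.ReflTransGen.tail ih ?_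
    obtain ⟨h0, h⟩ := h
    refine ⟨h0, ?_⟩
    simp only
    rcases h with ⟨h, h'⟩ | ⟨h, h'⟩ | ⟨h, h'⟩
    · exact Or.inl ⟨by omega, h'⟩
    · exact Or.inr (Or.inl ⟨by omega, h'⟩)
    · exact Or.inr (Or.inr ⟨by omega, h'⟩)

/-- shift in unpacked form -/
theorem LConn_shift' {l : ℕ} {q : Query n Var} {p p' : Fin n} {i j i' j' : ℤ}
    (h : LConn l q (p, i) (p', j)) (e : i' - i = j' - j) :
    LConn l q (p, i') (p', j') := by
  have := LConn_shift (i' - i) h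
  simp only at this
  have e1 : i + (i' - i) = i' := by omega
  have e2 : j + (i' - i) = j' := by omega
  rwa [e1, e2] at this

theorem tri_adj {l : ℕ} {q : Query n Var} {tri : ℤ → Fin n → Elem}
    (htri : ∀ i, solPair q (tri (i+1)) (tri i)) {u v : Fin n × ℤ} (h : LAdj l q u v) :
    tri u.2 u.1 = tri v.2 v.1 := by
  obtain ⟨⟨h1, h2⟩, h⟩ := h
  rcases h with ⟨h, h' | h'⟩ | ⟨h, h'⟩ | ⟨h, h'⟩
  · rw [h]
    have := htri (v.2 - 1)
    rw [sub_add_cancel] at this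
    exact PA_of_sol this _ _ h1 h2 h'
  · rw [h]
    exact PB_of_sol (htri v.2) _ _ h1 h2 h'
  · rw [h]
    obtain ⟨μ, ha, hb⟩ := htri v.2
    rw [← ha, ← hb, h']
  · rw [h]
    obtain ⟨μ, ha, hb⟩ := htri u.2
    rw [← ha, ← hb, h']

theorem tri_conn {l : ℕ} {q : Query n Var} {tri : ℤ → Fin n → Elem}
    (htri : ∀ i, solPair q (tri (i+1)) (tri i)) {u v : Fin n × ℤ} (h : LConn l q u v) :
    tri u.2 u.1 = tri v.2 v.1 := by
  induction h with
  | refl => rfl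
  | tail _ h ih => exact ih.trans (tri_adj htri h)

/-- path data -/
structure IsLP (l : ℕ) (q : Query n Var) (tri : ℤ → Fin n → Elem) (x : Elem) (M : ℤ)
    (k : ℕ) (P : ℕ → Fin n × ℤ) : Prop where
  adj : ∀ j, j < k → LAdj l q (P j) (P (j+1))
  lo : (P 0).2 ≤ -M
  hi : M ≤ (P k).2
  val : ∀ j, j ≤ k → tri (P j).2 (P j).1 = x

def LongPath (l : ℕ) (q : Query n Var) (tri : ℤ → Fin n → Elem) (x : Elem) (M : ℤ) : Prop :=
  ∃ k P, IsLP l q tri x M k P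

theorem LConn_path {l : ℕ} {q : Query n Var} {u v : Fin n × ℤ} (h : LConn l q u v) :
    ∃ (k : ℕ) (P : ℕ → Fin n × ℤ), P 0 = u ∧ P k = v ∧ ∀ j, j < k → LAdj l q (P j) (P (j+1)) := by
  induction h with
  | refl => exact ⟨0, fun _ => u, rfl, rfl, fun j hj => absurd hj (Nat.not_lt_zero j)⟩
  | @tail b c _ h ih =>
    obtain ⟨k, P, h0, hk, hP⟩ := ih
    refine ⟨k+1, fun j => if j ≤ k then P j else c, by simp [h0], by simp, ?_⟩
    intro j hj
    by_cases hjk : j = k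
    · subst hjk
      simpa [hk] using h
    · have h1 : j ≤ k := by omega
      have h2 : j + 1 ≤ k := by omega
      simp only [h1, h2, if_true]
      exact hP j (by omega)

theorem longPath_of_conn {l : ℕ} {q : Query n Var} {tri : ℤ → Fin n → Elem}
    (htri : ∀ i, solPair q (tri (i+1)) (tri i)) {u v : Fin n × ℤ} {M : ℤ}
    (h : LConn l q u v) (hu : u.2 ≤ -M) (hv : M ≤ v.2) :
    LongPath l q tri (tri u.2 u.1) M := by
  obtain ⟨k, P, h0, hk, hP⟩ := LConn_path h
  refine ⟨k, P, hP, by rw [h0]; exact hu, by rw [hk]; exact hv, ?_⟩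
  intro j
  induction j with
  | zero => intro _; rw [h0]
  | succ j ih =>
    intro hj
    rw [← tri_adj htri (hP j (by omega))]
    exact ih (by omega)

open Classical in
noncomputable def lowc (k : ℕ) (P : ℕ → Fin n × ℤ) (x : Elem) (t : Fin n → Elem) (i : ℤ) : ℤ :=
  ∑ j ∈ Finset.range k,
    ((if (P j).2 = i - 1 ∧ (P (j+1)).2 = i ∧ t (P (j+1)).1 = x then 1 else 0)
      - (if (P j).2 = i ∧ (P (j+1)).2 = i - 1 ∧ t (P j).1 = x then 1 else 0))

open Classical in
noncomputable def upc (k : ℕ) (P : ℕ → Fin n × ℤ) (x : Elem) (t : Fin n → Elem) (i : ℤ) : ℤ :=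
  ∑ j ∈ Finset.range k,
    ((if (P j).2 = i ∧ (P (j+1)).2 = i + 1 ∧ t (P j).1 = x then 1 else 0)
      - (if (P j).2 = i + 1 ∧ (P (j+1)).2 = i ∧ t (P (j+1)).1 = x then 1 else 0))

theorem lowc_eq_upc {l : ℕ} {q : Query n Var} {tri : ℤ → Fin n → Elem} {x : Elem} {M : ℤ}
    {k : ℕ} {P : ℕ → Fin n × ℤ} (h : IsLP l q tri x M k P) {t : Fin n → Elem} {i : ℤ}
    (hA : PA l q t) (hB : PB l q t) (hi : |i| < M) : lowc k P x t i = upc k P x t i := by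
  classical
  rw [abs_lt] at hi
  have key := Finset.sum_range_sub
    (fun j => if (P j).2 = i ∧ t (P j).1 = x then (1 : ℤ) else 0) k
  have hlo := h.lo
  have hhi := h.hi
  have e0 : ¬ ((P 0).2 = i) := by omega
  have ek : ¬ ((P k).2 = i) := by omega
  simp only [e0, ek, false_and, if_false, sub_self] at key
  rw [← sub_eq_zero, ← key, lowc, upc, ← Finset.sum_sub_distrib]
  refine Finset.sum_congr rfl ?_
  intro j hj
  rw [Finset.mem_range] at hj
  obtain ⟨⟨h1, h2⟩, h3⟩ := h.adj j hj
  rcases h3 with ⟨h3, h4⟩ | ⟨h3, h4⟩ | ⟨h3, h4⟩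
  · have ht : t (P j).1 = t (P (j+1)).1 := by
      rcases h4 with h4 | h4
      · exact hA _ _ h1 h2 h4
      · exact hB _ _ h1 h2 h4
    rw [ht]
    by_cases x2 : t (P (j+1)).1 = x <;>
      simp only [x2, and_true, and_false, if_false] <;> (try split_ifs) <;> omega
  · by_cases x1 : t (P j).1 = x <;> by_cases x2 : t (P (j+1)).1 = x <;>
      simp only [x1, x2, and_true, and_false, if_false] <;> (try split_ifs) <;> omega
  · by_cases x1 : t (P j).1 = x <;> by_cases x2 : t (P (j+1)).1 = x <;>
      simp only [x1, x2, and_true, and_false, if_false] <;> (try split_ifs) <;> omega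

theorem lowc_sol {l : ℕ} {q : Query n Var} {tri : ℤ → Fin n → Elem} {x : Elem} {M : ℤ}
    {k : ℕ} {P : ℕ → Fin n × ℤ} (h : IsLP l q tri x M k P) {a b : Fin n → Elem} (i : ℤ)
    (hs : solPair q a b) : lowc k P x a (i+1) = upc k P x b i := by
  classical
  obtain ⟨μ, ha, hb⟩ := hs
  rw [lowc, upc]
  refine Finset.sum_congr rfl ?_
  intro j hj
  rw [Finset.mem_range] at hj
  obtain ⟨_, h3⟩ := h.adj j hj
  rw [add_sub_cancel_right]
  rcases h3 with ⟨h3, h4⟩ | ⟨h3, h4⟩ | ⟨h3, h4⟩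
  · rw [h3]
    split_ifs <;> first | rfl | omega
  · have : a (P j).1 = b (P (j+1)).1 := by rw [← ha, ← hb, h4]
    rw [h3, this]
    split_ifs <;> first | rfl | omega
  · have : a (P (j+1)).1 = b (P j).1 := by rw [← ha, ← hb, h4]
    rw [h3, this]
    split_ifs <;> first | rfl | omega

theorem lowc_tri {l : ℕ} {q : Query n Var} {tri : ℤ → Fin n → Elem} {x : Elem} {M : ℤ}
    {k : ℕ} {P : ℕ → Fin n × ℤ} (h : IsLP l q tri x M k P) {i : ℤ} (hi : |i| < M) :
    lowc k P x (tri i) i = 1 := by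
  classical
  rw [abs_lt] at hi
  have key := Finset.sum_range_sub
    (fun j => if i ≤ (P j).2 then (1 : ℤ) else 0) k
  have hlo := h.lo
  have hhi := h.hi
  have e0 : ¬ (i ≤ (P 0).2) := by omega
  have ek : i ≤ (P k).2 := by omega
  simp only [e0, ek, if_false, if_true, sub_zero] at key
  rw [← key, lowc]
  refine Finset.sum_congr rfl ?_
  intro j hj
  rw [Finset.mem_range] at hj
  obtain ⟨_, h3⟩ := h.adj j hj
  have v1 := h.val j (by omega)
  have v2 := h.val (j+1) (by omega)
  have c1 : ((P j).2 = i - 1 ∧ (P (j+1)).2 = i ∧ tri i (P (j+1)).1 = x) ↔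
      ((P j).2 = i - 1 ∧ (P (j+1)).2 = i) := by
    constructor
    · rintro ⟨a, b, _⟩; exact ⟨a, b⟩
    · rintro ⟨a, b⟩; exact ⟨a, b, by rw [b] at v2; exact v2⟩
  have c2 : ((P j).2 = i ∧ (P (j+1)).2 = i - 1 ∧ tri i (P j).1 = x) ↔
      ((P j).2 = i ∧ (P (j+1)).2 = i - 1) := by
    constructor
    · rintro ⟨a, b, _⟩; exact ⟨a, b⟩
    · rintro ⟨a, b⟩; exact ⟨a, b, by rw [a] at v1; exact v1⟩
  rw [if_congr c1 rfl rfl, if_congr c2 rfl rfl]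
  have h5 : (P j).2 = (P (j+1)).2 ∨ (P j).2 = (P (j+1)).2 + 1 ∨ (P (j+1)).2 = (P j).2 + 1 := by
    rcases h3 with h3 | h3 | h3
    · exact Or.inl h3.1
    · exact Or.inr (Or.inl h3.1)
    · exact Or.inr (Or.inr h3.1)
  split_ifs <;> omega

theorem lowc_congr {l : ℕ} {q : Query n Var} {tri : ℤ → Fin n → Elem} {x : Elem} {M : ℤ}
    {k : ℕ} {P : ℕ → Fin n × ℤ} (h : IsLP l q tri x M k P) {a b : Fin n → Elem} {i : ℤ}
    (hab : keyEq l a b) : lowc k P x a i = lowc k P x b i := by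
  rw [lowc, lowc]
  refine Finset.sum_congr rfl ?_
  intro j hj
  rw [Finset.mem_range] at hj
  obtain ⟨⟨h1, h2⟩, _⟩ := h.adj j hj
  rw [hab _ h1, hab _ h2]

theorem upc_congr {l : ℕ} {q : Query n Var} {tri : ℤ → Fin n → Elem} {x : Elem} {M : ℤ}
    {k : ℕ} {P : ℕ → Fin n × ℤ} (h : IsLP l q tri x M k P) {a b : Fin n → Elem} {i : ℤ}
    (hab : keyEq l a b) : upc k P x a i = upc k P x b i := by
  rw [upc, upc]
  refine Finset.sum_congr rfl ?_
  intro j hj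
  rw [Finset.mem_range] at hj
  obtain ⟨⟨h1, h2⟩, _⟩ := h.adj j hj
  rw [hab _ h1, hab _ h2]

theorem mem_of_lowc {l : ℕ} {q : Query n Var} {tri : ℤ → Fin n → Elem} {x : Elem} {M : ℤ}
    {k : ℕ} {P : ℕ → Fin n × ℤ} (h : IsLP l q tri x M k P) {a : Fin n → Elem} {i : ℤ}
    (hne : lowc k P x a i = 1) : x ∈ keySet l a := by
  by_contra hx
  rw [lowc, Finset.sum_eq_zero] at hne
  · exact absurd hne (by norm_num)
  · intro j hj
    rw [Finset.mem_range] at hj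
    obtain ⟨⟨h1, h2⟩, _⟩ := h.adj j hj
    have e1 : ¬ (a (P j).1 = x) := fun e => hx ⟨_, h1, e⟩
    have e2 : ¬ (a (P (j+1)).1 = x) := fun e => hx ⟨_, h2, e⟩
    simp [e1, e2]

theorem mem_of_upc {l : ℕ} {q : Query n Var} {tri : ℤ → Fin n → Elem} {x : Elem} {M : ℤ}
    {k : ℕ} {P : ℕ → Fin n × ℤ} (h : IsLP l q tri x M k P) {a : Fin n → Elem} {i : ℤ}
    (hne : upc k P x a i = 1) : x ∈ keySet l a := by
  by_contra hx
  rw [upc, Finset.sum_eq_zero] at hne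
  · exact absurd hne (by norm_num)
  · intro j hj
    rw [Finset.mem_range] at hj
    obtain ⟨⟨h1, h2⟩, _⟩ := h.adj j hj
    have e1 : ¬ (a (P j).1 = x) := fun e => hx ⟨_, h1, e⟩
    have e2 : ¬ (a (P (j+1)).1 = x) := fun e => hx ⟨_, h2, e⟩
    simp [e1, e2]

/-- persistence predicate -/
def Pst (l : ℕ) (q : Query n Var) (tri : ℤ → Fin n → Elem) (t : Fin n → Elem) : Prop :=
  (PA l q t ∨ PB l q t) ∧ ∃ m lam : ℤ, |lam| ≤ m ∧
    ∀ (x : Elem) (M : ℤ) (k : ℕ) (P : ℕ → Fin n × ℤ), m < M → IsLP l q tri x M k P →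
      (PA l q t → lowc k P x t lam = 1) ∧ (PB l q t → upc k P x t lam = 1)

theorem Pst_tri {l : ℕ} {q : Query n Var} {tri : ℤ → Fin n → Elem}
    (htri : ∀ i, solPair q (tri (i+1)) (tri i)) (i : ℤ) : Pst l q tri (tri i) := by
  have hA : PA l q (tri i) := by
    have := htri (i - 1)
    rw [sub_add_cancel] at this
    exact PA_of_sol this
  have hB : PB l q (tri i) := PB_of_sol (htri i)
  refine ⟨Or.inl hA, |i|, i, le_rfl, ?_⟩
  intro x M k P hM h
  refine ⟨fun _ => lowc_tri h hM, fun _ => ?_⟩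
  rw [← lowc_eq_upc h hA hB hM]
  exact lowc_tri h hM

theorem Pst_congr {l : ℕ} {q : Query n Var} {tri : ℤ → Fin n → Elem} {a b : Fin n → Elem}
    (hab : keyEq l a b) (h : Pst l q tri a) : Pst l q tri b := by
  obtain ⟨h0, m, lam, hl, h⟩ := h
  refine ⟨h0.imp (PA_congr hab) (PB_congr hab), m, lam, hl, ?_⟩
  intro x M k P hM hP
  obtain ⟨h1, h2⟩ := h x M k P hM hP
  exact ⟨fun hA => by rw [← lowc_congr hP hab]; exact h1 (PA_congr (keyEq_symm hab) hA),
    fun hB => by rw [← upc_congr hP hab]; exact h2 (PB_congr (keyEq_symm hab) hB)⟩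

theorem Pst_sol {l : ℕ} {q : Query n Var} {tri : ℤ → Fin n → Elem} {a b : Fin n → Elem}
    (hab : solPair q a b) (h : Pst l q tri a) : Pst l q tri b := by
  obtain ⟨h0, m, lam, hl, h⟩ := h
  have hB : PB l q b := PB_of_sol hab
  have hl' : |lam - 1| ≤ m + 1 := by rw [abs_le] at hl ⊢; omega
  refine ⟨Or.inr hB, m + 1, lam - 1, hl', ?_⟩
  intro x M k P hM hP
  obtain ⟨h1, h2⟩ := h x M k P (by omega) hP
  have e := lowc_sol hP (lam - 1) hab
  rw [sub_add_cancel, h1 (PA_of_sol hab)] at e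
  exact ⟨fun hA => by exact (lowc_eq_upc hP hA hB (by omega)).trans e.symm, fun _ => e.symm⟩

theorem Pst_sol' {l : ℕ} {q : Query n Var} {tri : ℤ → Fin n → Elem} {a b : Fin n → Elem}
    (hab : solPair q a b) (h : Pst l q tri b) : Pst l q tri a := by
  obtain ⟨h0, m, lam, hl, h⟩ := h
  have hA : PA l q a := PA_of_sol hab
  have hl' : |lam + 1| ≤ m + 1 := by rw [abs_le] at hl ⊢; omega
  refine ⟨Or.inl hA, m + 1, lam + 1, hl', ?_⟩
  intro x M k P hM hP
  obtain ⟨h1, h2⟩ := h x M k P (by omega) hP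
  have e := lowc_sol hP lam hab
  rw [h2 (PB_of_sol hab)] at e
  exact ⟨fun _ => e, fun hB => by rw [← lowc_eq_upc hP hA hB (by omega), e]⟩

theorem Pst_mem {l : ℕ} {q : Query n Var} {tri : ℤ → Fin n → Elem} {t : Fin n → Elem}
    (h : Pst l q tri t) : ∃ m : ℤ, ∀ x M, m < M → LongPath l q tri x M → x ∈ keySet l t := by
  obtain ⟨h0, m, lam, hl, h⟩ := h
  refine ⟨m, ?_⟩
  rintro x M hM ⟨k, P, hP⟩
  obtain ⟨h1, h2⟩ := h x M k P hM hP
  rcases h0 with h0 | h0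
  · exact mem_of_lowc hP (h1 h0)
  · exact mem_of_upc hP (h2 h0)

end helpers
end CQA

namespace CQA
section helpers
variable {n : ℕ} {Elem Var : Type}

def triF (d e f : Fin n → Elem) (j : ℤ) : Fin n → Elem :=
  if j % 3 = 0 then e else if j % 3 = 1 then d else f

theorem triF_sol {q : Query n Var} {d e f : Fin n → Elem} (h1 : solPair q d e)
    (h2 : solPair q e f) (h3 : solPair q f d) (i : ℤ) :
    solPair q (triF d e f (i+1)) (triF d e f i) := by
  have : i % 3 = 0 ∨ i % 3 = 1 ∨ i % 3 = 2 := by omega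
  rcases this with h | h | h
  · have h' : (i+1) % 3 = 1 := by omega
    simpa [triF, h, h'] using h1
  · have h' : (i+1) % 3 = 2 := by omega
    simpa [triF, h, h'] using h3
  · have h' : (i+1) % 3 = 0 := by omega
    simpa [triF, h, h'] using h2

theorem gSet_sub {l : ℕ} {d e f c : Fin n → Elem} (hc : c = d ∨ c = e ∨ c = f)
    (hd : keySet l c ⊆ keySet l d) (he : keySet l c ⊆ keySet l e)
    (hf : keySet l c ⊆ keySet l f) : gSet l d e f ⊆ keySet l c := by
  unfold gSet
  split_ifs with h1 h2 h3 h4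
  · rcases hc with rfl | rfl | rfl
    · exact le_rfl
    · exact h1.1
    · exact absurd he h1.2
  · rcases hc with rfl | rfl | rfl
    · exact absurd he h2.1
    · exact h2.2
    · exact le_rfl
  · rcases hc with rfl | rfl | rfl
    · exact le_rfl
    · exact h3.1.trans h3.2
    · exact h3.1
  · rcases hc with rfl | rfl | rfl
    · exact h4.1
    · exact h4.1.trans h4.2
    · exact le_rfl
  · rcases hc with rfl | rfl | rfl
    · exfalso; tauto
    · exact le_rfl
    · exfalso; tauto

theorem main1 {l : ℕ} {q : Query n Var} {d e f u : Fin n → Elem} (h1 : solPair q d e)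
    (h2 : solPair q e f) (h3 : solPair q f d) (hu : Pst l q (triF d e f) u)
    (hg : ¬ gSet l d e f ⊆ keySet l u) :
    ∃ M : ℤ, ∀ c : ℤ, ∃ y ∈ keySet l (triF d e f c), ¬ LongPath l q (triF d e f) y M := by
  have htri := triF_sol h1 h2 h3
  obtain ⟨m0, hm0⟩ := Pst_mem hu
  obtain ⟨m1, hm1⟩ := Pst_mem (Pst_tri (l := l) htri 1)
  obtain ⟨m2, hm2⟩ := Pst_mem (Pst_tri (l := l) htri 0)
  obtain ⟨m3, hm3⟩ := Pst_mem (Pst_tri (l := l) htri 2)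
  have e1 : triF d e f 1 = d := by simp [triF]
  have e2 : triF d e f 0 = e := by simp [triF]
  have e3 : triF d e f 2 = f := by simp [triF]
  rw [e1] at hm1
  rw [e2] at hm2
  rw [e3] at hm3
  refine ⟨max (max m0 m1) (max m2 m3) + 1, ?_⟩
  intro c
  by_contra hcon
  push Not at hcon
  have hc : triF d e f c = d ∨ triF d e f c = e ∨ triF d e f c = f := by
    unfold triF
    split_ifs <;> simp
  apply hg
  refine (gSet_sub hc ?_ ?_ ?_).trans ?_
  · exact fun y hy => hm1 y _ (by omega) (hcon y hy)
  · exact fun y hy => hm2 y _ (by omega) (hcon y hy)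
  · exact fun y hy => hm3 y _ (by omega) (hcon y hy)
  · exact fun y hy => hm0 y _ (by omega) (hcon y hy)

theorem dicho {l : ℕ} {q : Query n Var} (ε : ℤ)
    (h : ∀ p : Fin n, (p : ℕ) < l → ∃ p' : Fin n, (p' : ℕ) < l ∧ LConn l q (p, 0) (p', ε)) :
    ∀ p : Fin n, (p : ℕ) < l → ∃ p' : Fin n, (p' : ℕ) < l ∧ LConn l q (p, 0) (p', -ε) := by
  let S := {p : Fin n // (p : ℕ) < l}
  let r : Setoid S := ⟨fun p p' => LConn l q (p.1, 0) (p'.1, 0),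
    ⟨fun _ => Relation.ReflTransGen.refl, fun h => LConn_symm h, fun h h' => LConn_trans h h'⟩⟩
  choose φ hφ1 hφ2 using h
  let φ' : S → S := fun p => ⟨φ p.1 p.2, hφ1 p.1 p.2⟩
  have hφ : ∀ p : S, LConn l q (p.1, 0) ((φ' p).1, ε) := fun p => hφ2 p.1 p.2
  let F : Quotient r → Quotient r := Quotient.map φ' (by
    intro a b hab
    have hab' : LConn l q (a.1, 0) (b.1, 0) := hab
    have : LConn l q ((φ' a).1, ε) ((φ' b).1, ε) :=
      LConn_trans (LConn_symm (hφ a)) (LConn_trans hab' (hφ b))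
    exact LConn_shift' this (by ring))
  have hinj : Function.Injective F := by
    intro x y
    induction x using Quotient.inductionOn with | _ a =>
    induction y using Quotient.inductionOn with | _ b =>
    intro hxy
    have h1 : LConn l q ((φ' a).1, 0) ((φ' b).1, 0) := Quotient.exact hxy
    have h2 : LConn l q ((φ' a).1, ε) ((φ' b).1, ε) := LConn_shift' h1 (by ring)
    exact Quotient.sound (LConn_trans (hφ a) (LConn_trans h2 (LConn_symm (hφ b))))
  have hsurj : Function.Surjective F := Finite.injective_iff_surjective.mp hinj
  intro p hp
  obtain ⟨x, hx⟩ := hsurj (Quotient.mk r ⟨p, hp⟩)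
  induction x using Quotient.inductionOn with | _ a =>
  have h1 : LConn l q ((φ' a).1, 0) (p, 0) := Quotient.exact hx
  have h2 : LConn l q ((φ' a).1, ε) (p, ε) := LConn_shift' h1 (by ring)
  have h3 := LConn_symm (LConn_trans (hφ a) h2)
  exact ⟨a.1, a.2, LConn_shift' h3 (by ring)⟩

theorem spread {l : ℕ} {q : Query n Var} (ε : ℤ)
    (h : ∀ p : Fin n, (p : ℕ) < l → ∃ p' : Fin n, (p' : ℕ) < l ∧ LConn l q (p, 0) (p', ε))
    (m : ℕ) (p : Fin n) (hp : (p : ℕ) < l) :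
    ∃ p' : Fin n, (p' : ℕ) < l ∧ LConn l q (p, 0) (p', m * ε) := by
  induction m with
  | zero => exact ⟨p, hp, by rw [Nat.cast_zero, zero_mul]; exact Relation.ReflTransGen.refl⟩
  | succ m ih =>
    obtain ⟨p', hp', hc⟩ := ih
    obtain ⟨p'', hp'', hc'⟩ := h p' hp'
    exact ⟨p'', hp'', LConn_trans hc (LConn_shift' hc' (by push_cast; ring))⟩

theorem escape {l : ℕ} {q : Query n Var} {tri : ℤ → Fin n → Elem}
    (htri : ∀ i, solPair q (tri (i+1)) (tri i)) {M : ℤ}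
    (hM : ∃ y ∈ keySet l (tri 0), ¬ LongPath l q tri y M) (ε : ℤ) (hε : ε = 1 ∨ ε = -1) (i : ℤ) :
    ∃ p : Fin n, (p : ℕ) < l ∧ ∀ p' : Fin n, (p' : ℕ) < l → ¬ LConn l q (p, i) (p', i + ε) := by
  by_contra hcon
  push Not at hcon
  have h : ∀ p : Fin n, (p : ℕ) < l → ∃ p' : Fin n, (p' : ℕ) < l ∧ LConn l q (p, 0) (p', ε) := by
    intro p hp
    obtain ⟨p', hp', hc⟩ := hcon p hp
    exact ⟨p', hp', LConn_shift' hc (by ring)⟩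
  have h' := dicho ε h
  obtain ⟨y, ⟨p, hp, rfl⟩, hy⟩ := hM
  apply hy
  obtain ⟨p1, hp1, hc1⟩ := spread ε h M.toNat p hp
  obtain ⟨p2, hp2, hc2⟩ := spread (-ε) h' M.toNat p hp
  rcases hε with rfl | rfl
  · have := longPath_of_conn htri (M := M) (LConn_trans (LConn_symm hc2) hc1)
      (by simp only; omega) (by simp only; omega)
    rwa [← tri_conn htri hc2] at this
  · have := longPath_of_conn htri (M := M) (LConn_trans (LConn_symm hc1) hc2)
      (by simp only; omega) (by simp only; omega)
    rwa [← tri_conn htri hc1] at this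

end helpers
end CQA

namespace CQA
section helpers
variable {n : ℕ} {Elem Var : Type}

structure IsWalk (l : ℕ) (q : Query n Var) (L R : ℕ → Fin n → Elem) (lev : ℕ → ℤ) : Prop where
  step : ∀ j, (lev (j+1) = lev j - 1 ∧ solPair q (L j) (R j)) ∨
    (lev (j+1) = lev j + 1 ∧ solPair q (R j) (L j))
  link : ∀ j, keyEq l (R j) (L (j+1))

def WalkP (l : ℕ) (q : Query n Var) (x : Fin n → Elem) : Prop :=
  ∀ i M : ℤ, ∃ (L R : ℕ → Fin n → Elem) (lev : ℕ → ℤ), IsWalk l q L R lev ∧ lev 0 = i ∧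
    keyEq l x (L 0) ∧ ∃ k, (∃ j, j ≤ k ∧ M ≤ lev j) ∧ (∃ j, j ≤ k ∧ lev j ≤ -M)

theorem WalkP_congr {l : ℕ} {q : Query n Var} {x y : Fin n → Elem} (h : keyEq l x y)
    (hy : WalkP l q y) : WalkP l q x := by
  intro i M
  obtain ⟨L, R, lev, hw, h0, hk, h⟩ := hy i M
  exact ⟨L, R, lev, hw, h0, keyEq_trans ‹_› hk, h⟩

theorem WalkP_cons {l : ℕ} {q : Query n Var} {a b : Fin n → Elem}
    (h : solPair q a b ∨ solPair q b a) (hy : WalkP l q b) : WalkP l q a := by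
  intro i M
  obtain ⟨s, hs⟩ : ∃ s : ℤ, (s = i - 1 ∧ solPair q a b) ∨ (s = i + 1 ∧ solPair q b a) := by
    rcases h with h | h
    · exact ⟨_, Or.inl ⟨rfl, h⟩⟩
    · exact ⟨_, Or.inr ⟨rfl, h⟩⟩
  obtain ⟨L, R, lev, hw, h0, hk, k, ⟨j1, hj1, hM1⟩, ⟨j2, hj2, hM2⟩⟩ := hy s M
  refine ⟨fun j => Nat.casesOn j a L, fun j => Nat.casesOn j b R, fun j => Nat.casesOn j i lev,
    ⟨?_, ?_⟩, rfl, keyEq_rfl, k+1, ⟨j1+1, by omega, hM1⟩, ⟨j2+1, by omega, hM2⟩⟩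
  · intro j
    cases j with
    | zero => simpa [h0] using hs
    | succ j => exact hw.step j
  · intro j
    cases j with
    | zero => exact hk
    | succ j => exact hw.link j

theorem WalkP_tri {l : ℕ} {q : Query n Var} {tri : ℤ → Fin n → Elem}
    (htri : ∀ i, solPair q (tri (i+1)) (tri i)) : WalkP l q (tri 0) := by
  intro i M
  let u : ℕ := i.natAbs + M.natAbs
  let lev : ℕ → ℤ := fun j => i + u - |(j : ℤ) - u|
  refine ⟨fun j => tri (lev j - i), fun j => tri (lev (j+1) - i), lev, ⟨?_, fun j => keyEq_rfl⟩,
    ?_, ?_, 3 * u, ⟨u, by omega, ?_⟩, ⟨3 * u, le_rfl, ?_⟩⟩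
  · intro j
    have : lev (j+1) = lev j - 1 ∨ lev (j+1) = lev j + 1 := by
      simp only [lev]
      push_cast
      rcases abs_cases ((j : ℤ) - u) with h | h <;> rcases abs_cases ((j : ℤ) + 1 - u) with h' | h' <;>
        omega
    rcases this with h | h
    · left
      refine ⟨h, ?_⟩
      have := htri (lev (j+1) - i)
      have e : lev (j+1) - i + 1 = lev j - i := by omega
      rwa [e] at this
    · right
      refine ⟨h, ?_⟩
      have := htri (lev j - i)
      have e : lev j - i + 1 = lev (j+1) - i := by omega
      rwa [e] at this
  · simp [lev]
  · simp [lev, keyEq_rfl]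
  · simp only [lev, sub_self, abs_zero]
    omega
  · simp only [lev]
    push_cast
    rcases abs_cases (3 * (u : ℤ) - u) with h | h <;> omega

theorem WalkP_rel {l : ℕ} {q : Query n Var} {D : Set (Fin n → Elem)} {x y : Fin n → Elem}
    (h : qConnRel l q D x y) : WalkP l q x ↔ WalkP l q y := by
  rcases h with h | ⟨a, b, ha, hb, h⟩
  · exact ⟨WalkP_congr (keyEq_symm h), WalkP_congr h⟩
  · have hs : solPair q a b ∨ solPair q b a := h.imp (fun h => h.2.2) (fun h => h.2.2)
    constructor
    · intro hx
      exact WalkP_congr hb.2 (WalkP_cons hs.symm (WalkP_congr (keyEq_symm ha.2) hx))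
    · intro hy
      exact WalkP_congr ha.2 (WalkP_cons hs (WalkP_congr (keyEq_symm hb.2) hy))

theorem WalkP_conn {l : ℕ} {q : Query n Var} {D : Set (Fin n → Elem)} {x y : Fin n → Elem}
    (h : qConn l q D x y) : WalkP l q x ↔ WalkP l q y := by
  unfold qConn at h
  induction h with
  | rel x y h => exact WalkP_rel h
  | refl x => exact Iff.rfl
  | symm x y _ ih => exact ih.symm
  | trans x y z _ _ ih1 ih2 => exact ih1.trans ih2

end helpers
end CQA

namespace CQA
section helpers
variable {n : ℕ} {Elem Var : Type}

def Vis (l : ℕ) (q : Query n Var) (lev : ℕ → ℤ) (j : ℕ) (p : Fin n) (j' : ℕ) : Prop :=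
  j' ≤ j ∧ ∀ i, j' ≤ i → i ≤ j → ∃ p' : Fin n, (p' : ℕ) < l ∧ LConn l q (p, lev j) (p', lev i)

noncomputable def stp (l : ℕ) (q : Query n Var) (lev : ℕ → ℤ) (j : ℕ) (p : Fin n) : ℕ :=
  sInf {j' | Vis l q lev j p j'}

theorem stp_mem {l : ℕ} {q : Query n Var} {lev : ℕ → ℤ} {j : ℕ} {p : Fin n} (hp : (p : ℕ) < l) :
    Vis l q lev j p (stp l q lev j p) := by
  have : {j' | Vis l q lev j p j'}.Nonempty := by
    refine ⟨j, le_rfl, ?_⟩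
    intro i h1 h2
    have : i = j := le_antisymm h2 h1
    subst this
    exact ⟨p, hp, Relation.ReflTransGen.refl⟩
  exact Nat.sInf_mem this

theorem Vis_congr {l : ℕ} {q : Query n Var} {lev : ℕ → ℤ} {j j' : ℕ} {p p' : Fin n}
    (h : LConn l q (p, lev j) (p', lev j)) (hv : Vis l q lev j p j') : Vis l q lev j p' j' := by
  refine ⟨hv.1, ?_⟩
  intro i h1 h2
  obtain ⟨r, hr, hc⟩ := hv.2 i h1 h2
  exact ⟨r, hr, LConn_trans (LConn_symm h) hc⟩

theorem stp_congr {l : ℕ} {q : Query n Var} {lev : ℕ → ℤ} {j : ℕ} {p p' : Fin n}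
    (h : LConn l q (p, lev j) (p', lev j)) : stp l q lev j p = stp l q lev j p' := by
  have : {i | Vis l q lev j p i} = {i | Vis l q lev j p' i} :=
    Set.ext fun i => ⟨Vis_congr h, Vis_congr (LConn_symm h)⟩
  rw [stp, stp, this]

theorem stp_step {l : ℕ} {q : Query n Var} {lev : ℕ → ℤ} {j : ℕ} {p p' : Fin n}
    (hp : (p : ℕ) < l) (hp' : (p' : ℕ) < l)
    (h : LConn l q (p, lev j) (p', lev (j+1))) : stp l q lev j p = stp l q lev (j+1) p' := by
  have hv := stp_mem (q := q) (lev := lev) (j := j) hp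
  have hv' := stp_mem (q := q) (lev := lev) (j := j+1) hp'
  have h1 : stp l q lev (j+1) p' ≤ stp l q lev j p := by
    apply Nat.sInf_le
    refine ⟨by have := hv.1; omega, ?_⟩
    intro i h1 h2
    by_cases hi : i = j + 1
    · subst hi
      exact ⟨p', hp', Relation.ReflTransGen.refl⟩
    · obtain ⟨r, hr, hc⟩ := hv.2 i h1 (by omega)
      exact ⟨r, hr, LConn_trans (LConn_symm h) hc⟩
  refine le_antisymm ?_ h1
  apply Nat.sInf_le
  refine ⟨h1.trans hv.1, ?_⟩
  intro i h1 h2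
  obtain ⟨r, hr, hc⟩ := hv'.2 i h1 (by omega)
  exact ⟨r, hr, LConn_trans h hc⟩

theorem stp_fresh {l : ℕ} {q : Query n Var} {lev : ℕ → ℤ} {j : ℕ} {p : Fin n} (hp : (p : ℕ) < l)
    (h : ∀ p' : Fin n, (p' : ℕ) < l → ¬ LConn l q (p, lev (j+1)) (p', lev j)) :
    stp l q lev (j+1) p = j + 1 := by
  have hv := stp_mem (q := q) (lev := lev) (j := j+1) hp
  have := hv.1
  by_contra hne
  obtain ⟨r, hr, hc⟩ := hv.2 j (by omega) (by omega)
  exact h r hr hc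

theorem stp_zero {l : ℕ} {q : Query n Var} {lev : ℕ → ℤ} {p : Fin n} (hp : (p : ℕ) < l) :
    stp l q lev 0 p = 0 := Nat.le_zero.mp (stp_mem hp).1

theorem lift_sol {l : ℕ} {q : Query n Var} {γ : Type} (ι : Elem × Elem × γ → Elem) (z : γ)
    {a b a' b' : Fin n → Elem} (h : solPair q a b) (h' : solPair q a' b') {sa sb : Fin n → γ}
    (hA : ∀ p p' : Fin n, (p : ℕ) < l → (p' : ℕ) < l → q.1 p = q.1 p' → sa p = sa p')
    (hB : ∀ p p' : Fin n, (p : ℕ) < l → (p' : ℕ) < l → q.2 p = q.2 p' → sb p = sb p')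
    (hAB : ∀ p p' : Fin n, (p : ℕ) < l → (p' : ℕ) < l → q.1 p = q.2 p' → sa p = sb p') :
    ∃ A B : Fin n → Elem, solPair q A B ∧
      (∀ p : Fin n, (p : ℕ) < l → A p = ι (a p, a' p, sa p)) ∧
      (∀ p : Fin n, (p : ℕ) < l → B p = ι (b p, b' p, sb p)) ∧
      (∀ r, ∃ x y c, A r = ι (x, y, c) ∧
        (c = z ∨ ∃ p : Fin n, (p : ℕ) < l ∧ (c = sa p ∨ c = sb p))) ∧
      (∀ r, ∃ x y c, B r = ι (x, y, c) ∧
        (c = z ∨ ∃ p : Fin n, (p : ℕ) < l ∧ (c = sa p ∨ c = sb p))) := by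
  classical
  obtain ⟨μ, h1, h2⟩ := h
  obtain ⟨ν, h1', h2'⟩ := h'
  let col : Var → γ := fun v =>
    if hv : ∃ p : Fin n, (p : ℕ) < l ∧ q.1 p = v then sa hv.choose
    else if hv : ∃ p : Fin n, (p : ℕ) < l ∧ q.2 p = v then sb hv.choose else z
  have hcol : ∀ v, col v = z ∨ ∃ p : Fin n, (p : ℕ) < l ∧ (col v = sa p ∨ col v = sb p) := by
    intro v
    simp only [col]
    split_ifs with e1 e2
    · exact Or.inr ⟨_, e1.choose_spec.1, Or.inl rfl⟩
    · exact Or.inr ⟨_, e2.choose_spec.1, Or.inr rfl⟩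
    · exact Or.inl rfl
  have c1 : ∀ p : Fin n, (p : ℕ) < l → col (q.1 p) = sa p := by
    intro p hp
    have e1 : ∃ p' : Fin n, (p' : ℕ) < l ∧ q.1 p' = q.1 p := ⟨p, hp, rfl⟩
    simp only [col, dif_pos e1]
    exact hA _ _ e1.choose_spec.1 hp e1.choose_spec.2
  have c2 : ∀ p : Fin n, (p : ℕ) < l → col (q.2 p) = sb p := by
    intro p hp
    by_cases e1 : ∃ p' : Fin n, (p' : ℕ) < l ∧ q.1 p' = q.2 p
    · simp only [col, dif_pos e1]
      exact hAB _ _ e1.choose_spec.1 hp e1.choose_spec.2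
    · have e2 : ∃ p' : Fin n, (p' : ℕ) < l ∧ q.2 p' = q.2 p := ⟨p, hp, rfl⟩
      simp only [col, dif_neg e1, dif_pos e2]
      exact hB _ _ e2.choose_spec.1 hp e2.choose_spec.2
  let κ : Var → Elem := fun v => ι (μ v, ν v, col v)
  refine ⟨fun r => κ (q.1 r), fun r => κ (q.2 r), ⟨κ, fun _ => rfl, fun _ => rfl⟩, ?_, ?_, ?_, ?_⟩
  · intro p hp
    simp only [κ, c1 p hp, h1, h1']
  · intro p hp
    simp only [κ, c2 p hp, h2, h2']
  · exact fun r => ⟨_, _, _, rfl, hcol _⟩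
  · exact fun r => ⟨_, _, _, rfl, hcol _⟩

def code (b τ : ℕ) : ℕ × ℕ := if τ = 0 then (0, 0) else (b, τ)

theorem code_snd (b τ : ℕ) : (code b τ).2 = τ := by
  unfold code; split_ifs with h <;> simp [h]

/-- one lifted step -/
theorem lift_step {l : ℕ} {q : Query n Var} (hq : TwoWayDet l q)
    {tri : ℤ → Fin n → Elem} (htri : ∀ i, solPair q (tri (i+1)) (tri i))
    (hesc : ∀ ε : ℤ, (ε = 1 ∨ ε = -1) → ∀ i : ℤ, ∃ p : Fin n, (p : ℕ) < l ∧
      ∀ p' : Fin n, (p' : ℕ) < l → ¬ LConn l q (p, i) (p', i + ε))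
    (ι : Elem × Elem × (ℕ × ℕ) → Elem) {L R : ℕ → Fin n → Elem} {lev : ℕ → ℤ}
    (hw : IsWalk l q L R lev) (b j : ℕ) :
    ∃ A B : Fin n → Elem, (solPair q A B ∨ solPair q B A) ∧
      (∀ p : Fin n, (p : ℕ) < l →
        A p = ι (L j p, tri (lev j) p, code b (stp l q lev j p))) ∧
      (∀ p : Fin n, (p : ℕ) < l →
        B p = ι (R j p, tri (lev (j+1)) p, code b (stp l q lev (j+1) p))) ∧
      (∃ r x y c, A r = ι (x, y, c) ∧ c.2 = j + 1) ∧
      (∀ r, ∃ x y c, B r = ι (x, y, c) ∧ c.2 ≤ j + 1) := by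
  have hfresh : ∃ p : Fin n, (p : ℕ) < l ∧ stp l q lev (j+1) p = j + 1 := by
    rcases hw.step j with ⟨h, _⟩ | ⟨h, _⟩
    · obtain ⟨p, hp, hc⟩ := hesc 1 (Or.inl rfl) (lev (j+1))
      refine ⟨p, hp, stp_fresh hp ?_⟩
      have e : lev j = lev (j+1) + 1 := by omega
      rw [e]; exact hc
    · obtain ⟨p, hp, hc⟩ := hesc (-1) (Or.inr rfl) (lev (j+1))
      refine ⟨p, hp, stp_fresh hp ?_⟩
      have e : lev j = lev (j+1) + -1 := by omega
      rw [e]; exact hc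
  obtain ⟨p0, hp0, hs0⟩ := hfresh
  have cA : ∀ i : ℕ, ∀ p p' : Fin n, (p : ℕ) < l → (p' : ℕ) < l → q.1 p = q.1 p' →
      code b (stp l q lev i p) = code b (stp l q lev i p') := by
    intro i p p' hp hp' e
    rw [stp_congr (p := p) (p' := p')]
    exact Relation.ReflTransGen.single ⟨⟨hp, hp'⟩, Or.inl ⟨rfl, Or.inl e⟩⟩
  have cB : ∀ i : ℕ, ∀ p p' : Fin n, (p : ℕ) < l → (p' : ℕ) < l → q.2 p = q.2 p' →
      code b (stp l q lev i p) = code b (stp l q lev i p') := by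
    intro i p p' hp hp' e
    rw [stp_congr (p := p) (p' := p')]
    exact Relation.ReflTransGen.single ⟨⟨hp, hp'⟩, Or.inl ⟨rfl, Or.inr e⟩⟩
  have hle : ∀ i ≤ j + 1, ∀ p : Fin n, (p : ℕ) < l → (code b (stp l q lev i p)).2 ≤ j + 1 := by
    intro i hi p hp
    rw [code_snd]
    exact (stp_mem hp).1.trans hi
  rcases hw.step j with ⟨h, hs⟩ | ⟨h, hs⟩
  · have ht : solPair q (tri (lev j)) (tri (lev (j+1))) := by
      have := htri (lev (j+1))
      have e : lev (j+1) + 1 = lev j := by omega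
      rwa [e] at this
    obtain ⟨A, B, h1, h2, h3, h4, h5⟩ := lift_sol (l := l) ι (0, 0) hs ht (cA j) (cB (j+1)) (by
      intro p p' hp hp' e
      rw [stp_step hp hp']
      exact Relation.ReflTransGen.single ⟨⟨hp, hp'⟩, Or.inr (Or.inl ⟨by simp only; omega, e⟩)⟩)
    refine ⟨A, B, Or.inl h1, h2, h3, ?_, ?_⟩
    · obtain ⟨r, hr⟩ := hq.2.2.2 ⟨p0, hp0, rfl⟩
      obtain ⟨κ, k1, k2⟩ := h1
      exact ⟨r, R j p0, tri (lev (j+1)) p0, code b (stp l q lev (j+1) p0),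
        by rw [← k1, hr, k2, h3 p0 hp0], by rw [code_snd, hs0]⟩
    · intro r
      obtain ⟨x, y, c, e, hc⟩ := h5 r
      refine ⟨x, y, c, e, ?_⟩
      rcases hc with rfl | ⟨p, hp, rfl | rfl⟩
      · simp
      · exact hle j (by omega) p hp
      · exact hle (j+1) le_rfl p hp
  · have ht : solPair q (tri (lev (j+1))) (tri (lev j)) := by
      have := htri (lev j)
      rwa [← h] at this
    obtain ⟨B, A, h1, h3, h2, h5, h4⟩ := lift_sol (l := l) ι (0, 0) hs ht (cA (j+1)) (cB j) (by
      intro p p' hp hp' e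
      rw [← stp_step hp' hp]
      exact Relation.ReflTransGen.single ⟨⟨hp', hp⟩, Or.inr (Or.inr ⟨by simp only; omega, e⟩)⟩)
    refine ⟨A, B, Or.inr h1, h2, h3, ?_, ?_⟩
    · obtain ⟨r, hr⟩ := hq.2.2.1 ⟨p0, hp0, rfl⟩
      obtain ⟨κ, k1, k2⟩ := h1
      exact ⟨r, R j p0, tri (lev (j+1)) p0, code b (stp l q lev (j+1) p0),
        by rw [← k2, hr, k1, h3 p0 hp0], by rw [code_snd, hs0]⟩
    · intro r
      obtain ⟨x, y, c, e, hc⟩ := h5 r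
      refine ⟨x, y, c, e, ?_⟩
      rcases hc with rfl | ⟨p, hp, rfl | rfl⟩
      · simp
      · exact hle (j+1) le_rfl p hp
      · exact hle j (by omega) p hp

/-- a lifted branch -/
theorem lift_branch {l : ℕ} {q : Query n Var} (hq : TwoWayDet l q)
    {tri : ℤ → Fin n → Elem} (htri : ∀ i, solPair q (tri (i+1)) (tri i))
    (hesc : ∀ ε : ℤ, (ε = 1 ∨ ε = -1) → ∀ i : ℤ, ∃ p : Fin n, (p : ℕ) < l ∧
      ∀ p' : Fin n, (p' : ℕ) < l → ¬ LConn l q (p, i) (p', i + ε))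
    (ι : Elem × Elem × (ℕ × ℕ) → Elem) (hι : Function.Injective ι)
    {L R : ℕ → Fin n → Elem} {lev : ℕ → ℤ}
    (hw : IsWalk l q L R lev) (b : ℕ) (c : Fin n → Elem) (hc : keyEq l c (L 0)) :
    ∃ ar le : ℕ → Fin n → Elem,
      (ar 0 = fun r => ι (c r, tri (lev 0) r, (0, 0))) ∧
      (∀ j, solPair q (le j) (ar (j+1)) ∨ solPair q (ar (j+1)) (le j)) ∧
      (∀ j, ∀ p : Fin n, (p : ℕ) < l →
        ar j p = ι (L j p, tri (lev j) p, code b (stp l q lev j p))) ∧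
      (∀ j, ∀ p : Fin n, (p : ℕ) < l →
        le j p = ι (L j p, tri (lev j) p, code b (stp l q lev j p))) ∧
      (∀ j, le j ≠ ar j) := by
  choose A B h1 h2 h3 h4 h5 using fun j => lift_step hq htri hesc ι hw b j
  refine ⟨fun j => Nat.casesOn j (fun r => ι (c r, tri (lev 0) r, (0, 0))) B, A, rfl, h1, ?_, h2, ?_⟩
  · intro j p hp
    cases j with
    | zero =>
      change ι (c p, tri (lev 0) p, (0, 0)) = _
      rw [hc p hp, stp_zero hp]
      rfl
    | succ j =>
      change B j p = _
      rw [h3 j p hp, hw.link j p hp]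
  · intro j he
    obtain ⟨r, x, y, c1, e1, e2⟩ := h4 j
    rw [he] at e1
    cases j with
    | zero =>
      change ι (c r, tri (lev 0) r, (0, 0)) = _ at e1
      have := hι e1
      simp only [Prod.mk.injEq] at this
      rw [← this.2.2] at e2
      simp at e2
    | succ j =>
      change B j r = _ at e1
      obtain ⟨x', y', c2, e3, e4⟩ := h5 j r
      rw [e3] at e1
      have := hι e1
      simp only [Prod.mk.injEq] at this
      rw [this.2.2] at e4
      omega

end helpers
end CQA

namespace CQA
section helpers
variable {n : ℕ} {Elem Var : Type}

theorem assemble {l : ℕ} {q : Query n Var} {I : Type} [Fintype I] (parent : I → Option I)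
    (root leaf1 leaf2 branch child1 child2 : I) (a b : I → Fin n → Elem)
    (parent_root : parent root = none)
    (parent_ne_root : ∀ i, i ≠ root → ∃ j, parent i = some j)
    (reach_root : ∀ i, Relation.ReflTransGen (fun x y => parent x = some y) i root)
    (leaf_ne : leaf1 ≠ leaf2)
    (leaf1_leaf : ∀ j, parent j ≠ some leaf1)
    (leaf2_leaf : ∀ j, parent j ≠ some leaf2)
    (leaves_eq : ∀ i, (∀ j, parent j ≠ some i) → i = leaf1 ∨ i = leaf2)
    (hab : ∀ i, keyEq l (a i) (b i))
    (hinj : ∀ i j, keyEq l (a i) (a j) → i = j)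
    (hroot : b root = a root) (hleaf1 : a leaf1 = b leaf1) (hleaf2 : a leaf2 = b leaf2)
    (hother : ∀ i, i ≠ root → i ≠ leaf1 → i ≠ leaf2 → a i ≠ b i)
    (hadj : ∀ i j, parent j = some i → solPair q (a i) (b j) ∨ solPair q (b j) (a i))
    (child_ne : child1 ≠ child2)
    (parent_child1 : parent child1 = some branch)
    (parent_child2 : parent child2 = some branch)
    (sol1 : solPair q (b child1) (a branch))
    (sol2 : solPair q (a branch) (b child2))
    (dist : (b child1, a branch) ≠ (a branch, b child2))
    (nsol : ¬ solPair q (b child2) (b child1))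
    (g_root : ¬ gSet l (b child1) (a branch) (b child2) ⊆ keySet l (a root))
    (g_leaf1 : ¬ gSet l (b child1) (a branch) (b child2) ⊆ keySet l (b leaf1))
    (g_leaf2 : ¬ gSet l (b child1) (a branch) (b child2) ⊆ keySet l (b leaf2)) :
    AdmitsForkTripath l q Elem := by
  classical
  let e := Fintype.equivFin I
  let Θ : Set (Fin n → Elem) := Set.range a ∪ Set.range b
  have ha : ∀ i, a i ∈ Θ := fun i => Or.inl ⟨i, rfl⟩
  have hb : ∀ i, b i ∈ Θ := fun i => Or.inr ⟨i, rfl⟩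
  have hfin : Θ.Finite := (Set.finite_range a).union (Set.finite_range b)
  have hblock : ∀ i, ({a i, b i} : Set (Fin n → Elem)) = Block l Θ (a i) := by
    intro i
    ext t
    constructor
    · rintro (rfl | rfl)
      · exact ⟨ha i, keyEq_rfl⟩
      · exact ⟨hb i, hab i⟩
    · rintro ⟨⟨j, rfl⟩ | ⟨j, rfl⟩, h⟩
      · have := hinj _ _ h
        subst this
        exact Or.inl rfl
      · have := hinj _ _ (keyEq_trans h (keyEq_symm (hab j)))
        subst this
        exact Or.inr rfl
  have hpar : ∀ x y : Fin (Fintype.card I),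
      (parent (e.symm x)).map e = some y ↔ parent (e.symm x) = some (e.symm y) := by
    intro x y
    rw [Option.map_eq_some_iff]
    constructor
    · rintro ⟨z, hz, rfl⟩
      simpa using hz
    · intro h
      exact ⟨_, h, by simp⟩
  refine ⟨Θ, hfin, Θ, le_rfl, ?_⟩
  let T : Tripath l q Θ :=
    { finite := hfin
      m := Fintype.card I
      blk := fun x => {a (e.symm x), b (e.symm x)}
      blk_is_block := fun x => ⟨_, ha (e.symm x), hblock _⟩
      blk_cover := by
        ext t
        rw [Set.mem_iUnion]
        constructor
        · rintro (⟨i, rfl⟩ | ⟨i, rfl⟩)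
          · exact ⟨e i, by simp⟩
          · exact ⟨e i, by simp⟩
        · rintro ⟨x, rfl | rfl⟩
          · exact ha _
          · exact hb _
      blk_inj := by
        intro x y h
        simp only [hblock] at h
        have h1 : a (e.symm y) ∈ Block l Θ (a (e.symm x)) := by
          rw [h]
          exact ⟨ha _, keyEq_rfl⟩
        exact e.symm.injective (hinj _ _ h1.2)
      blk_card := fun x => (Set.ncard_insert_le _ _).trans (by simp)
      parent := fun x => (parent (e.symm x)).map e
      root := e root
      parent_root := by simp [parent_root]
      parent_ne_root := by
        intro x hx
        obtain ⟨j, hj⟩ := parent_ne_root (e.symm x) (fun h => hx (by simp [← h]))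
        exact ⟨e j, by simp [hj]⟩
      reach_root := by
        intro x
        have := (reach_root (e.symm x)).lift (p := fun x y => (parent (e.symm x)).map e = some y) e
          (by intro u v huv; simp [Function.onFun, huv])
        simpa [Function.onFun] using this
      leaf1 := e leaf1
      leaf2 := e leaf2
      leaf_ne := fun h => leaf_ne (e.injective h)
      leaf1_leaf := by
        intro x h
        rw [hpar] at h
        exact leaf1_leaf _ (by simpa using h)
      leaf2_leaf := by
        intro x h
        rw [hpar] at h
        exact leaf2_leaf _ (by simpa using h)
      leaves_eq := by
        intro x hx
        have := leaves_eq (e.symm x) (by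
          intro j hj
          apply hx (e j)
          simp [hj])
        rcases this with h | h
        · left; simp [← h]
        · right; simp [← h]
      aFact := fun x => a (e.symm x)
      bFact := fun x => b (e.symm x)
      root_blk := by simp [hroot]
      leaf1_blk := by simp [hleaf1]
      leaf2_blk := by simp [hleaf2]
      other_blk := by
        intro x h1 h2 h3
        refine ⟨hother _ ?_ ?_ ?_, rfl⟩
        · rintro rfl; simp at h1
        · rintro rfl; simp at h2
        · rintro rfl; simp at h3
      adj_sol := by
        intro x y h
        rw [hpar] at h
        rcases hadj _ _ h with h | h
        · exact Or.inl ⟨ha _, hb _, h⟩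
        · exact Or.inr ⟨hb _, ha _, h⟩
      branch := e branch
      child1 := e child1
      child2 := e child2
      child_ne := fun h => child_ne (e.injective h)
      parent_child1 := by simp [parent_child1]
      parent_child2 := by simp [parent_child2]
      center_sol1 := by simpa using ⟨hb _, ha _, sol1⟩
      center_sol2 := by simpa using ⟨ha _, hb _, sol2⟩
      center_distinct := by simpa using dist
      g_root := by simpa using g_root
      g_leaf1 := by simpa using g_leaf1
      g_leaf2 := by simpa using g_leaf2 }
  refine ⟨T, ?_⟩
  intro h
  apply nsol
  have := h.2.2
  simpa [T, Tripath.fc, Tripath.dc] using this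

end helpers
end CQA

namespace CQA
section helpers
variable {n : ℕ} {Elem Var : Type}

def par3 (k : ℕ) (x : Fin 3 × Fin (k+1)) : Option (Fin 3 × Fin (k+1)) :=
  if x.1 = 0 then (if h : (x.2 : ℕ) < k then some (0, ⟨x.2 + 1, by omega⟩) else none)
  else if (x.2 : ℕ) = 0 then some (0, 0) else some (x.1, ⟨x.2 - 1, by omega⟩)

theorem par3_some {k : ℕ} {x y : Fin 3 × Fin (k+1)} (h : par3 k x = some y) :
    (x.1 = 0 ∧ (x.2 : ℕ) < k ∧ y.1 = 0 ∧ (y.2 : ℕ) = x.2 + 1) ∨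
    (x.1 ≠ 0 ∧ (x.2 : ℕ) = 0 ∧ y.1 = 0 ∧ (y.2 : ℕ) = 0) ∨
    (x.1 ≠ 0 ∧ y.1 = x.1 ∧ (x.2 : ℕ) = y.2 + 1) := by
  unfold par3 at h
  split_ifs at h with h1 h2 h3
  · rw [Option.some.injEq] at h
    subst h
    exact Or.inl ⟨h1, h2, rfl, rfl⟩
  · rw [Option.some.injEq] at h
    subst h
    exact Or.inr (Or.inl ⟨h1, h3, rfl, rfl⟩)
  · rw [Option.some.injEq] at h
    subst h
    exact Or.inr (Or.inr ⟨h1, rfl, by simp only; omega⟩)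

theorem assemble3 {l : ℕ} {q : Query n Var} (ar le : Fin 3 → ℕ → Fin n → Elem) (k : ℕ)
    (hk1 : 1 ≤ k)
    (hs : ∀ b j, solPair q (le b j) (ar b (j+1)) ∨ solPair q (ar b (j+1)) (le b j))
    (hk : ∀ b j, keyEq l (ar b j) (le b j))
    (hinj : ∀ b j b' j', keyEq l (ar b j) (ar b' j') → b = b' ∧ j = j')
    (hne : ∀ b j, le b j ≠ ar b j)
    (sol1 : solPair q (ar 1 0) (ar 0 0)) (sol2 : solPair q (ar 0 0) (ar 2 0))
    (nsol : ¬ solPair q (ar 2 0) (ar 1 0))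
    (hg : ∀ b, ¬ gSet l (ar 1 0) (ar 0 0) (ar 2 0) ⊆ keySet l (ar b k)) :
    AdmitsForkTripath l q Elem := by
  let lea : Fin 3 → ℕ → Fin n → Elem := fun b j => if j < k then le b j else ar b j
  have hlea : ∀ b j, j < k → lea b j = le b j := fun b j hj => by simp only [lea, if_pos hj]
  have hlea' : ∀ b, lea b k = ar b k := fun b => by simp only [lea, lt_irrefl, if_false]
  have hkl : ∀ b j, keyEq l (ar b j) (lea b j) := by
    intro b j
    simp only [lea]
    split_ifs
    · exact hk b j
    · exact keyEq_rfl
  let A : Fin 3 × Fin (k+1) → Fin n → Elem := fun x => if x.1 = 0 then ar x.1 x.2 else lea x.1 x.2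
  let B : Fin 3 × Fin (k+1) → Fin n → Elem := fun x => if x.1 = 0 then lea x.1 x.2 else ar x.1 x.2
  have hAar : ∀ x, keyEq l (ar x.1 x.2) (A x) := by
    intro x
    simp only [A]
    split_ifs
    · exact keyEq_rfl
    · exact hkl _ _
  have hBar : ∀ x, keyEq l (ar x.1 x.2) (B x) := by
    intro x
    simp only [B]
    split_ifs
    · exact hkl _ _
    · exact keyEq_rfl
  have a00 : A (0, 0) = ar 0 0 := by simp [A]
  have b10 : B (1, 0) = ar 1 0 := by simp [B]
  have b20 : B (2, 0) = ar 2 0 := by simp [B]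
  have r0 : ∀ m : ℕ, ∀ j : Fin (k+1), (j : ℕ) + m = k →
      Relation.ReflTransGen (fun x y => par3 k x = some y) (0, j) (0, Fin.last k) := by
    intro m
    induction m with
    | zero =>
      intro j hj
      have : j = Fin.last k := Fin.ext (by simpa using hj)
      rw [this]
    | succ m ih =>
      intro j hj
      refine Relation.ReflTransGen.head ?_ (ih ⟨j + 1, by omega⟩ (by simp only; omega))
      have : (j : ℕ) < k := by omega
      simp [par3, this]
  have r1 : ∀ b : Fin 3, ∀ m : ℕ, ∀ j : Fin (k+1), (j : ℕ) = m → b ≠ 0 →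
      Relation.ReflTransGen (fun x y => par3 k x = some y) (b, j) (0, 0) := by
    intro b m
    induction m with
    | zero =>
      intro j hj hb
      refine Relation.ReflTransGen.single ?_
      simp [par3, hb, hj]
    | succ m ih =>
      intro j hj hb
      refine Relation.ReflTransGen.head ?_ (ih ⟨j - 1, by omega⟩ (by simp only; omega) hb)
      have : (j : ℕ) ≠ 0 := by omega
      simp only [par3, hb, this, if_false]
  refine assemble (par3 k) (0, Fin.last k) (1, Fin.last k) (2, Fin.last k) (0, 0) (1, 0) (2, 0)
    A B ?_ ?_ ?_ ?_ ?_ ?_ ?_ ?_ ?_ ?_ ?_ ?_ ?_ ?_ ?_ ?_ ?_ ?_ ?_ ?_ ?_ ?_ ?_ ?_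
  · simp [par3]
  · intro i hi
    unfold par3
    split_ifs with h1 h2 h3
    · exact ⟨_, rfl⟩
    · exfalso
      apply hi
      refine Prod.ext h1 (Fin.ext ?_)
      simp only [Fin.val_last]
      omega
    · exact ⟨_, rfl⟩
    · exact ⟨_, rfl⟩
  · rintro ⟨b, j⟩
    by_cases hb : b = 0
    · subst hb
      exact r0 (k - j) j (by omega)
    · exact (r1 b j j rfl hb).trans (r0 k 0 (by simp))
  · simp
  · intro j h
    have := par3_some h
    simp at this
    omega
  · intro j h
    have := par3_some h
    simp at this
    omega
  · rintro ⟨b, j⟩ h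
    by_cases hb : b = 0
    · subst hb
      exfalso
      by_cases hj : (j : ℕ) = 0
      · have hj' : j = 0 := Fin.ext hj
        subst hj'
        exact h (1, 0) (by simp [par3])
      · refine h (0, ⟨j - 1, by omega⟩) ?_
        have h1 : (j : ℕ) - 1 < k := by omega
        have h2 : (j : ℕ) - 1 + 1 = j := by omega
        simp [par3, h1, h2]
    · by_cases hj : (j : ℕ) = k
      · have hj' : j = Fin.last k := Fin.ext hj
        subst hj'
        have : b = 1 ∨ b = 2 := by omega
        rcases this with rfl | rfl
        · exact Or.inl rfl
        · exact Or.inr rfl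
      · exfalso
        refine h (b, ⟨j + 1, by omega⟩) ?_
        simp [par3, hb]
  · exact fun i => keyEq_trans (keyEq_symm (hAar i)) (hBar i)
  · intro i j h
    obtain ⟨h1, h2⟩ := hinj _ _ _ _ (keyEq_trans (hAar i) (keyEq_trans h (keyEq_symm (hAar j))))
    exact Prod.ext h1 (Fin.ext h2)
  · simp [A, B, hlea']
  · simp [A, B, hlea']
  · simp [A, B, hlea']
  · rintro ⟨b, j⟩ h1 h2 h3
    have hj : (j : ℕ) < k := by
      by_contra hj
      have hj' : j = Fin.last k := Fin.ext (by simp only [Fin.val_last]; omega)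
      subst hj'
      have : b = 0 ∨ b = 1 ∨ b = 2 := by omega
      rcases this with rfl | rfl | rfl
      · exact h1 rfl
      · exact h2 rfl
      · exact h3 rfl
    simp only [A, B]
    rw [hlea _ _ hj]
    split_ifs
    · exact (hne _ _).symm
    · exact hne _ _
  · rintro ⟨b, j⟩ ⟨b', j'⟩ h
    rcases par3_some h with ⟨h1, h2, h3, h4⟩ | ⟨h1, h2, h3, h4⟩ | ⟨h1, h3, h4⟩
    · simp only at h1 h2 h3 h4
      subst h1 h3
      simp only [A, B, if_true, h4]
      rw [hlea _ _ h2]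
      exact (hs 0 _).symm
    · simp only at h1 h2 h3 h4
      subst h3
      simp only [A, B, if_true, if_neg h1, h2, h4]
      have : b' = 1 ∨ b' = 2 := by omega
      rcases this with rfl | rfl
      · exact Or.inr sol1
      · exact Or.inl sol2
    · simp only at h1 h3 h4
      subst h3
      simp only [A, B, if_neg h1, h4]
      rw [hlea _ _ (by omega)]
      exact hs _ _
  · simp
  · simp [par3]
  · simp [par3]
  · rw [a00, b10]; exact sol1
  · rw [a00, b20]; exact sol2
  · rw [a00, b10, b20]
    intro h
    have h' : ar 1 0 = ar 0 0 := congrArg Prod.fst h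
    have := (hinj 1 0 0 0 (by rw [h']; exact keyEq_rfl)).1
    exact absurd this (by decide)
  · rw [b10, b20]; exact nsol
  · rw [a00, b10, b20, ← keySet_congr (hAar _)]
    simpa using hg 0
  · rw [a00, b10, b20, ← keySet_congr (hBar _)]
    simpa using hg 1
  · rw [a00, b10, b20, ← keySet_congr (hBar _)]
    simpa using hg 2

end helpers
end CQA

namespace CQA
section helpers
variable {n : ℕ} {Elem Var : Type}

theorem fresh_exists {l : ℕ} {q : Query n Var}
    (hesc : ∀ ε : ℤ, (ε = 1 ∨ ε = -1) → ∀ i : ℤ, ∃ p : Fin n, (p : ℕ) < l ∧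
      ∀ p' : Fin n, (p' : ℕ) < l → ¬ LConn l q (p, i) (p', i + ε))
    {L R : ℕ → Fin n → Elem} {lev : ℕ → ℤ} (hw : IsWalk l q L R lev) (j : ℕ) :
    ∃ p : Fin n, (p : ℕ) < l ∧ stp l q lev (j+1) p = j + 1 := by
  rcases hw.step j with ⟨h, _⟩ | ⟨h, _⟩
  · obtain ⟨p, hp, hc⟩ := hesc 1 (Or.inl rfl) (lev (j+1))
    refine ⟨p, hp, stp_fresh hp ?_⟩
    have e : lev j = lev (j+1) + 1 := by omega
    rw [e]; exact hc
  · obtain ⟨p, hp, hc⟩ := hesc (-1) (Or.inr rfl) (lev (j+1))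
    refine ⟨p, hp, stp_fresh hp ?_⟩
    have e : lev j = lev (j+1) + -1 := by omega
    rw [e]; exact hc

theorem gSet_cases (l : ℕ) (d e f : Fin n → Elem) :
    gSet l d e f = keySet l d ∨ gSet l d e f = keySet l e ∨ gSet l d e f = keySet l f := by
  unfold gSet
  split_ifs <;> simp

theorem pair_sol {q : Query n Var} {γ : Type} (ι : Elem × Elem × γ → Elem) (z : γ)
    {a b a' b' : Fin n → Elem} (h : solPair q a b) (h' : solPair q a' b') :
    solPair q (fun r => ι (a r, a' r, z)) (fun r => ι (b r, b' r, z)) := by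
  obtain ⟨μ, h1, h2⟩ := h
  obtain ⟨ν, h1', h2'⟩ := h'
  exact ⟨fun v => ι (μ v, ν v, z), fun i => by simp only [h1, h1'], fun i => by simp only [h2, h2']⟩

theorem construct {l : ℕ} {q : Query n Var} (hq : TwoWayDet l q)
    {d0 e0 f0 u : Fin n → Elem} (h1 : solPair q d0 e0)
    (h2 : solPair q e0 f0) (h3 : solPair q f0 d0) (hu : Pst l q (triF d0 e0 f0) u)
    (hg : ¬ gSet l d0 e0 f0 ⊆ keySet l u)
    (nde : ¬ keyEq l d0 e0) (nef : ¬ keyEq l e0 f0) (ndf : ¬ keyEq l d0 f0)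
    {d e f : Fin n → Elem} (hde : solPair q d e) (hef : solPair q e f) (hfd : ¬ solPair q f d)
    (wd : WalkP l q d) (we : WalkP l q e) (wf : WalkP l q f)
    (ι : Elem × Elem × (ℕ × ℕ) → Elem) (hι : Function.Injective ι) [Nonempty Elem] :
    AdmitsForkTripath l q Elem := by
  obtain ⟨M, hM⟩ := main1 h1 h2 h3 hu hg
  have htri := triF_sol h1 h2 h3
  have t1 : triF d0 e0 f0 1 = d0 := by simp [triF]
  have t0 : triF d0 e0 f0 0 = e0 := by simp [triF]
  have t2 : triF d0 e0 f0 (-1) = f0 := by simp [triF]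
  generalize triF d0 e0 f0 = tri at *
  have hesc := escape (l := l) htri (hM 0)
  let c : Fin 3 → Fin n → Elem := ![e, d, f]
  let s : Fin 3 → ℤ := ![0, 1, -1]
  have hW : ∀ b, WalkP l q (c b) := by
    intro b
    fin_cases b
    · exact we
    · exact wd
    · exact wf
  have hN : ∀ b b', keyEq l (tri (s b)) (tri (s b')) → b = b' := by
    intro b b' h
    fin_cases b <;> fin_cases b' <;> simp [s, t0, t1, t2] at h ⊢
    · exact nde (keyEq_symm h)
    · exact nef h
    · exact nde h
    · exact ndf h
    · exact nef (keyEq_symm h)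
    · exact ndf (keyEq_symm h)
  choose L R lev hw hlev hkey k hk1 hk2 using fun b => hW b (s b) M
  choose ar le ar0 hs harK hleK hne using
    fun b : Fin 3 => lift_branch hq htri hesc ι hι (hw b) (b : ℕ) (c b) (hkey b)
  have ar0' : ∀ b, ar b 0 = fun r => ι (c b r, tri (s b) r, (0, 0)) := by
    intro b
    rw [ar0 b, hlev b]
  have hii : ∀ b j b' j', keyEq l (ar b j) (ar b' j') → j' ≤ j → b = b' ∧ j = j' := by
    intro b j b' j' h hj
    cases j with
    | zero =>
      have hj0 : j' = 0 := by omega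
      subst hj0
      refine ⟨hN b b' ?_, rfl⟩
      intro p hp
      have := h p hp
      rw [ar0' b, ar0' b'] at this
      have := hι this
      simp only [Prod.mk.injEq] at this
      exact this.2.1
    | succ j =>
      obtain ⟨p, hp, hst⟩ := fresh_exists hesc (hw b) j
      have := h p hp
      rw [harK b _ p hp, harK b' _ p hp] at this
      have := hι this
      simp only [Prod.mk.injEq] at this
      have hc := this.2.2
      rw [hst] at hc
      have hc2 := congrArg Prod.snd hc
      rw [code_snd, code_snd] at hc2
      have hle := (stp_mem (q := q) (lev := lev b') (j := j') hp).1
      have hjj : j + 1 = j' := by omega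
      refine ⟨?_, hjj⟩
      rw [← hc2] at hc
      simp only [code, Nat.succ_ne_zero, if_false, Prod.mk.injEq] at hc
      exact Fin.ext hc.1
  refine assemble3 ar le (k 0 + k 1 + k 2 + 1) (by omega) hs ?_ ?_ hne ?_ ?_ ?_ ?_
  · intro b j p hp
    rw [harK b j p hp, hleK b j p hp]
  · intro b j b' j' h
    rcases le_total j' j with hj | hj
    · exact hii b j b' j' h hj
    · have := hii b' j' b j (keyEq_symm h) hj
      exact ⟨this.1.symm, this.2.symm⟩
  · rw [ar0' 1, ar0' 0]
    refine pair_sol ι (0, 0) hde ?_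
    simpa [s, t0, t1] using h1
  · rw [ar0' 0, ar0' 2]
    refine pair_sol ι (0, 0) hef ?_
    simpa [s, t0, t2] using h2
  · rw [ar0' 1, ar0' 2]
    rintro ⟨μ, m1, m2⟩
    apply hfd
    have hinv := Function.leftInverse_invFun hι
    refine ⟨fun v => (Function.invFun ι (μ v)).1, ?_, ?_⟩
    · intro i
      simp only [m1]
      rw [hinv]
      rfl
    · intro i
      simp only [m2]
      rw [hinv]
      rfl
  · intro b hsub
    have : ∃ b', gSet l (ar 1 0) (ar 0 0) (ar 2 0) = keySet l (ar b' 0) := by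
      rcases gSet_cases l (ar 1 0) (ar 0 0) (ar 2 0) with h | h | h
      · exact ⟨1, h⟩
      · exact ⟨0, h⟩
      · exact ⟨2, h⟩
    obtain ⟨b', hb'⟩ := this
    rw [hb'] at hsub
    obtain ⟨y, ⟨p, hp, rfl⟩, hy⟩ := hM (s b')
    apply hy
    obtain ⟨p', hp', he⟩ := hsub ⟨p, hp, rfl⟩
    rw [harK b _ p' hp', ar0' b'] at he
    have he := hι he
    simp only [Prod.mk.injEq] at he
    obtain ⟨_, he1, he2⟩ := he
    have hst := congrArg Prod.snd he2
    rw [code_snd] at hst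
    simp only at hst
    have hv := stp_mem (q := q) (lev := lev b) (j := k 0 + k 1 + k 2 + 1) hp'
    rw [hst] at hv
    have hkb : k b ≤ k 0 + k 1 + k 2 + 1 := by
      fin_cases b <;> simp <;> omega
    obtain ⟨j1, hj1, hl1⟩ := hk1 b
    obtain ⟨j2, hj2, hl2⟩ := hk2 b
    obtain ⟨p1, hp1, hc1⟩ := hv.2 j1 (Nat.zero_le _) (by omega)
    obtain ⟨p2, hp2, hc2⟩ := hv.2 j2 (Nat.zero_le _) (by omega)
    have := longPath_of_conn htri (M := M) (LConn_trans (LConn_symm hc2) hc1) hl2 hl1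
    rw [← tri_conn htri hc2] at this
    simp only at this
    rwa [he1] at this

theorem tp_blk_eq {l : ℕ} {q : Query n Var} {Θ : Set (Fin n → Elem)} (T : Tripath l q Θ)
    {i j : Fin T.m} {u v : Fin n → Elem} (hu : u ∈ T.blk i) (hv : v ∈ T.blk j)
    (h : keyEq l u v) : i = j := by
  apply T.blk_inj
  obtain ⟨x, hx, hi⟩ := T.blk_is_block i
  obtain ⟨y, hy, hj⟩ := T.blk_is_block j
  rw [hi] at hu
  rw [hj] at hv
  have hxy : keyEq l x y := keyEq_trans hu.2 (keyEq_trans h (keyEq_symm hv.2))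
  rw [hi, hj]
  ext t
  exact ⟨fun ht => ⟨ht.1, keyEq_trans (keyEq_symm hxy) ht.2⟩,
    fun ht => ⟨ht.1, keyEq_trans hxy ht.2⟩⟩

theorem tp_b_mem {l : ℕ} {q : Query n Var} {Θ : Set (Fin n → Elem)} (T : Tripath l q Θ)
    {i : Fin T.m} (hi : i ≠ T.root) : T.bFact i ∈ T.blk i := by
  by_cases h1 : i = T.leaf1
  · rw [h1, T.leaf1_blk]; rfl
  by_cases h2 : i = T.leaf2
  · rw [h2, T.leaf2_blk]; rfl
  rw [(T.other_blk i hi h1 h2).2]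
  exact Or.inr rfl

theorem tp_a_mem {l : ℕ} {q : Query n Var} {Θ : Set (Fin n → Elem)} (T : Tripath l q Θ)
    {i j : Fin T.m} (hj : T.parent j = some i) : T.aFact i ∈ T.blk i := by
  by_cases h0 : i = T.root
  · rw [h0, T.root_blk]; rfl
  have h1 : i ≠ T.leaf1 := by rintro rfl; exact T.leaf1_leaf _ hj
  have h2 : i ≠ T.leaf2 := by rintro rfl; exact T.leaf2_leaf _ hj
  rw [(T.other_blk i h0 h1 h2).2]
  exact Or.inl rfl

theorem tp_keyEq {l : ℕ} {q : Query n Var} {Θ : Set (Fin n → Elem)} (T : Tripath l q Θ)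
    {i : Fin T.m} {u v : Fin n → Elem} (hu : u ∈ T.blk i) (hv : v ∈ T.blk i) : keyEq l u v := by
  obtain ⟨x, hx, hi⟩ := T.blk_is_block i
  rw [hi] at hu hv
  exact keyEq_trans (keyEq_symm hu.2) hv.2

theorem tp_irrefl {l : ℕ} {q : Query n Var} {Θ : Set (Fin n → Elem)} (T : Tripath l q Θ)
    (i : Fin T.m) : T.parent i ≠ some i := by
  intro h
  have : ∀ j, Relation.ReflTransGen (fun x y => T.parent x = some y) i j → j = i := by
    intro j hj
    induction hj with
    | refl => rfl
    | tail _ h' ih =>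
      subst ih
      rw [h] at h'
      exact (Option.some.inj h').symm
  have hr := this _ (T.reach_root i)
  rw [← hr, T.parent_root] at h
  exact absurd h (by simp)

theorem tp_ne_root {l : ℕ} {q : Query n Var} {Θ : Set (Fin n → Elem)} (T : Tripath l q Θ)
    {i j : Fin T.m} (h : T.parent i = some j) : i ≠ T.root := by
  rintro rfl
  rw [T.parent_root] at h
  exact absurd h (by simp)

theorem tp_Pst {l : ℕ} {q : Query n Var} {Θ : Set (Fin n → Elem)} (T : Tripath l q Θ)
    {tri : ℤ → Fin n → Elem} (h0 : Pst l q tri (T.aFact T.branch)) :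
    Pst l q tri (T.aFact T.root) := by
  have : ∀ i, Relation.ReflTransGen (fun x y => T.parent x = some y) T.branch i →
      Pst l q tri (T.aFact i) ∧ ∃ j, T.parent j = some i := by
    intro i hi
    induction hi with
    | refl => exact ⟨h0, _, T.parent_child1⟩
    | @tail x y _ hxy ih =>
      obtain ⟨hp, j, hj⟩ := ih
      refine ⟨?_, x, hxy⟩
      have hb : Pst l q tri (T.bFact x) :=
        Pst_congr (tp_keyEq T (tp_a_mem T hj) (tp_b_mem T (tp_ne_root T hxy))) hp
      rcases T.adj_sol y x hxy with h | h
      · exact Pst_sol' h.2.2 hb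
      · exact Pst_sol h.2.2 hb
  exact (this _ (T.reach_root _)).1

end helpers
end CQA

namespace CQA
theorem main_core (n l : ℕ) (hn : 1 ≤ n) (hl : l ≤ n)
    (Elem Var : Type) [Countable Elem] [Infinite Elem] [Countable Var] [Infinite Var]
    (q : CQA.Query n Var) (hq : CQA.TwoWayDet l q)
    (D : Set (Fin n → Elem)) (hD : D.Finite)
    (x : Fin n → Elem) (hx : x ∈ D)
    (hTri : ∃ Θ ⊆ CQA.qComponent l q D x, ∃ T : CQA.Tripath l q Θ, T.IsTriangle)
    (hFork : ∃ d e f : Fin n → Elem,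
      CQA.Sol q (CQA.qComponent l q D x) d e ∧
      CQA.Sol q (CQA.qComponent l q D x) e f ∧
      (d, e) ≠ (e, f) ∧
      ¬ CQA.Sol q (CQA.qComponent l q D x) f d) :
    CQA.AdmitsForkTripath l q Elem := by
  obtain ⟨Θ, hΘ, T, hT⟩ := hTri
  obtain ⟨d, e, f, hde, hef, -, hfd⟩ := hFork
  have h1 : solPair q (T.bFact T.child1) (T.aFact T.branch) := T.center_sol1.2.2
  have h2 : solPair q (T.aFact T.branch) (T.bFact T.child2) := T.center_sol2.2.2
  have h3 : solPair q (T.bFact T.child2) (T.bFact T.child1) := hT.2.2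
  have htri := triF_sol h1 h2 h3
  have t0 : triF (T.bFact T.child1) (T.aFact T.branch) (T.bFact T.child2) 0 = T.aFact T.branch := by
    simp [triF]
  have hP0 := Pst_tri (l := l) htri 0
  rw [t0] at hP0
  have hu := tp_Pst T hP0
  have m1 := tp_b_mem T (tp_ne_root T T.parent_child1)
  have m2 := tp_b_mem T (tp_ne_root T T.parent_child2)
  have m0 := tp_a_mem T T.parent_child1
  have nde : ¬ keyEq l (T.bFact T.child1) (T.aFact T.branch) := by
    intro h
    have hh := T.parent_child1
    rw [tp_blk_eq T m1 m0 h] at hh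
    exact tp_irrefl T _ hh
  have nef : ¬ keyEq l (T.aFact T.branch) (T.bFact T.child2) := by
    intro h
    have hh := T.parent_child2
    rw [← tp_blk_eq T m0 m2 h] at hh
    exact tp_irrefl T _ hh
  have ndf : ¬ keyEq l (T.bFact T.child1) (T.bFact T.child2) :=
    fun h => T.child_ne (tp_blk_eq T m1 m2 h)
  have wtri : WalkP l q (T.aFact T.branch) := by
    have := WalkP_tri (l := l) htri
    rwa [t0] at this
  have wx : WalkP l q x := (WalkP_conn (hΘ T.center_sol1.2.1).2).mpr wtri
  have hW : ∀ y ∈ qComponent l q D x, WalkP l q y := fun y hy => (WalkP_conn hy.2).mp wx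
  have hfd' : ¬ solPair q f d := fun h => hfd ⟨hef.2.1, hde.1, h⟩
  obtain ⟨φ, hφ⟩ := Countable.exists_injective_nat (Elem × Elem × (ℕ × ℕ))
  exact construct hq h1 h2 h3 hu T.g_root nde nef ndf hde.2.2 hef.2.2 hfd'
    (hW d hde.1) (hW e hde.2.1) (hW f hef.2.1)
    (fun z => Infinite.natEmbedding Elem (φ z))
    (fun a b hab => hφ ((Infinite.natEmbedding Elem).injective hab))

end CQA

/-- if a q-connected component of a database contains both a
triangle-tripath and a fork, then `q` admits a fork-tripath. -/
theorem fork_and_triangle_in_component (n l : ℕ) (hn : 1 ≤ n) (hl : l ≤ n)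
    (Elem Var : Type) [Countable Elem] [Infinite Elem] [Countable Var] [Infinite Var]
    (q : CQA.Query n Var) (hq : CQA.TwoWayDet l q)
    (D : Set (Fin n → Elem)) (hD : D.Finite)
    (x : Fin n → Elem) (hx : x ∈ D)
    (hTri : ∃ Θ ⊆ CQA.qComponent l q D x, ∃ T : CQA.Tripath l q Θ, T.IsTriangle)
    (hFork : ∃ d e f : Fin n → Elem,
      CQA.Sol q (CQA.qComponent l q D x) d e ∧
      CQA.Sol q (CQA.qComponent l q D x) e f ∧
      (d, e) ≠ (e, f) ∧
      ¬ CQA.Sol q (CQA.qComponent l q D x) f d) :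
    CQA.AdmitsForkTripath l q Elem := by
  exact CQA.main_core n l hn hl Elem Var q hq D hD x hx hTri hFork
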